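/- Suppose a < 0 and b < 0, and for each t ≥ 0 let c_t := lim_{Δ→∞} Δ^{1 + b/a} · Cov(X(t), X(t+Δ)) (this limit exists in ℝ for each t). Then lim_{t→∞} c_t / t^{b/a} = σ² b (|b| + |a|) / ( |a|³ (2|b| + |a|) ), a strictly negative number; in particular c_t → −∞ as t → ∞. -/

import Mathlib

open MeasureTheory ProbabilityTheory Filter Real Set

noncomputable section

/-- `B` is a standard one-dimensional Brownian motion adapted to the filtration `F`
under the probability measure `P`: all paths are continuous and start at `0`, the
increment `B t - B s` is Gaussian with mean `0` and variance `t - s`, and increments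
after time `s` are independent of `F s`. -/
def IsStdBrownian {Ω : Type*} {mΩ : MeasurableSpace Ω} (P : Measure Ω)
    (F : MeasureTheory.Filtration ℝ mΩ) (B : ℝ → Ω → ℝ) : Prop :=
  MeasureTheory.Adapted F B ∧
  (∀ ω, B 0 ω = 0) ∧
  (∀ ω, Continuous fun t => B t ω) ∧
  (∀ s t : ℝ, 0 ≤ s → s ≤ t →
    P.map (fun ω => B t ω - B s ω) = gaussianReal 0 (Real.toNNReal (t - s))) ∧
  (∀ s t : ℝ, 0 ≤ s → s ≤ t →
    Indep (MeasurableSpace.comap (fun ω => B t ω - B s ω) Real.measurableSpace) (F s) P)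

/-- `X` is the (continuous, adapted) solution of the affine stochastic functional
differential equation `dX(t) = (a X(t) + b/(1+t) ∫_{-1}^t X(s) ds) dt + σ dB(t)` for
`t ≥ 0`, with initial history `ψ` on `[-1, 0]`; i.e. almost surely, for all `t ≥ 0`,
`X t = ψ 0 + ∫_0^t (a X(s) + b/(1+s) (∫_{-1}^0 ψ(u) du + ∫_0^s X(u) du)) ds + σ B t`. -/
def IsSolutionSFDE {Ω : Type*} {mΩ : MeasurableSpace Ω} (P : Measure Ω)
    (F : MeasureTheory.Filtration ℝ mΩ) (a b σ : ℝ) (ψ : ℝ → ℝ)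
    (B X : ℝ → Ω → ℝ) : Prop :=
  (∀ t : ℝ, 0 ≤ t → StronglyMeasurable[F t] (X t)) ∧
  (∀ ω, ContinuousOn (fun t => X t ω) (Set.Ici (0 : ℝ))) ∧
  (∀ᵐ ω ∂P, ∀ t : ℝ, 0 ≤ t →
    X t ω = ψ 0
      + (∫ s in (0:ℝ)..t,
          (a * X s ω + b / (1 + s) * ((∫ u in (-1:ℝ)..(0:ℝ), ψ u) + ∫ u in (0:ℝ)..s, X u ω)))
      + σ * B t ω)

/-- The covariance `Cov(Y, Z) = E[Y Z] - E[Y] E[Z]` of two real random variables. -/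
def rcov {Ω : Type*} {mΩ : MeasurableSpace Ω} (P : Measure Ω) (Y Z : Ω → ℝ) : ℝ :=
  (∫ ω, Y ω * Z ω ∂P) - (∫ ω, Y ω ∂P) * (∫ ω, Z ω ∂P)

theorem le_of_hasDerivAt_le_mul_sub {f f' φ φ' : ℝ → ℝ} {T k G : ℝ} (hk : 0 < k)
    (hf : ContinuousOn f (Ici T)) (hφ : ContinuousOn φ (Ici T))
    (hf' : ∀ t, T < t → HasDerivAt f (f' t) t) (hφ' : ∀ t, T < t → HasDerivAt φ (φ' t) t)
    (h : ∀ t, T < t → f' t ≤ φ' t * (G - k * f t)) {t : ℝ} (ht : T ≤ t) :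
    f t ≤ G / k + (f T - G / k) * exp (-(k * (φ t - φ T))) := by
  have hF : AntitoneOn (fun t => exp (k * φ t) * (f t - G / k)) (Ici T) := by
    apply antitoneOn_of_hasDerivWithinAt_nonpos (convex_Ici T)
      (f' := fun t => exp (k * φ t) * (k * φ' t) * (f t - G / k) + exp (k * φ t) * f' t)
    · fun_prop
    · intro t ht
      rw [interior_Ici, mem_Ioi] at ht
      exact ((((hφ' t ht).const_mul k).exp).mul ((hf' t ht).sub_const (G / k))).hasDerivWithinAt
    · intro t ht
      rw [interior_Ici, mem_Ioi] at ht
      have e : exp (k * φ t) * (k * φ' t) * (f t - G / k) + exp (k * φ t) * f' t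
          = exp (k * φ t) * (f' t - φ' t * (G - k * f t)) := by field_simp; ring
      rw [e]
      exact mul_nonpos_of_nonneg_of_nonpos (exp_pos _).le (by linarith [h t ht])
  have h1 := hF (mem_Ici.2 le_rfl) (mem_Ici.2 ht) ht
  have e : exp (-(k * (φ t - φ T))) = exp (k * φ T) / exp (k * φ t) := by
    rw [← exp_sub]; ring_nf
  have hp := exp_pos (k * φ t)
  rw [e, ← sub_le_iff_le_add', mul_div_assoc', le_div_iff₀ hp]
  simp only at h1
  linarith

theorem eventually_lt_of_hasDerivAt_mul_sub {f φ φ' g : ℝ → ℝ} {k g₀ ε : ℝ} (hk : 0 < k)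
    (hf' : ∀ t, 0 < t → HasDerivAt f (φ' t * (g t - k * f t)) t)
    (hφ' : ∀ t, 0 < t → HasDerivAt φ (φ' t) t) (hφ0 : ∀ t, 0 < t → 0 ≤ φ' t)
    (hφ : Tendsto φ atTop atTop) (hg : ∀ δ > 0, ∀ᶠ t in atTop, g t < g₀ + δ) (hε : 0 < ε) :
    ∀ᶠ t in atTop, f t < g₀ / k + ε := by
  obtain ⟨T, hT⟩ := ((hg (k * (ε / 2)) (by positivity)).and (eventually_gt_atTop 0)).exists_forall_of_atTop
  have hT0 := (hT T le_rfl).2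
  have key : ∀ t, T ≤ t → f t ≤ (g₀ + k * (ε / 2)) / k
      + (f T - (g₀ + k * (ε / 2)) / k) * exp (-(k * (φ t - φ T))) := by
    intro t ht
    refine le_of_hasDerivAt_le_mul_sub hk
      (fun s hs => (hf' s (hT0.trans_le hs)).continuousAt.continuousWithinAt)
      (fun s hs => (hφ' s (hT0.trans_le hs)).continuousAt.continuousWithinAt)
      (fun s hs => hf' s (hT0.trans hs)) (fun s hs => hφ' s (hT0.trans hs)) ?_ ht
    intro s hs
    exact mul_le_mul_of_nonneg_left (by linarith [(hT s hs.le).1]) (hφ0 s (hT0.trans hs))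
  have hlim : Tendsto (fun t => (f T - (g₀ + k * (ε / 2)) / k) * exp (-(k * (φ t - φ T)))) atTop
      (nhds ((f T - (g₀ + k * (ε / 2)) / k) * 0)) := by
    apply Tendsto.const_mul
    apply tendsto_exp_atBot.comp
    apply tendsto_neg_atTop_atBot.comp
    exact (tendsto_atTop_add_const_right _ (-φ T) hφ).const_mul_atTop hk
  rw [mul_zero] at hlim
  filter_upwards [eventually_ge_atTop T, hlim.eventually_lt_const (half_pos hε)] with t h1 h2
  have h3 := key t h1
  have e : (g₀ + k * (ε / 2)) / k = g₀ / k + ε / 2 := by field_simp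
  rw [e] at h2 h3
  linarith

theorem tendsto_of_hasDerivAt_mul_sub {f φ φ' g : ℝ → ℝ} {k g₀ : ℝ} (hk : 0 < k)
    (hf' : ∀ t, 0 < t → HasDerivAt f (φ' t * (g t - k * f t)) t)
    (hφ' : ∀ t, 0 < t → HasDerivAt φ (φ' t) t) (hφ0 : ∀ t, 0 < t → 0 ≤ φ' t)
    (hφ : Tendsto φ atTop atTop) (hg : Tendsto g atTop (nhds g₀)) :
    Tendsto f atTop (nhds (g₀ / k)) := by
  rw [tendsto_order]
  constructor
  · intro u hu
    have := eventually_lt_of_hasDerivAt_mul_sub (f := fun t => -f t) (g := fun t => -g t)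
      (g₀ := -g₀) (ε := g₀ / k - u) hk
      (fun t ht => (hf' t ht).neg.congr_deriv (by ring)) hφ' hφ0 hφ
      (fun δ hδ => by
        filter_upwards [hg.eventually_const_lt (sub_lt_self g₀ hδ)] with t ht
        linarith) (by linarith)
    filter_upwards [this] with t ht
    rw [neg_div] at ht
    linarith
  · intro u hu
    have := eventually_lt_of_hasDerivAt_mul_sub (ε := u - g₀ / k) hk hf' hφ' hφ0 hφ
      (fun δ hδ => hg.eventually_lt_const (lt_add_of_pos_right g₀ hδ)) (by linarith)
    filter_upwards [this] with t ht
    linarith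

/-- Long-time behaviour of the second moments `m = E[M²]`, `n = E[M X]`, `v = E[X²]`, where
`M = ∫ X + X / α`. -/
theorem secondMoment_asymptotics {α β σ : ℝ} (hα : 0 < α) (hβ : 0 < β) {m n v : ℝ → ℝ}
    (hm : ∀ t, 0 < t → HasDerivAt m
      (-(2 * β / (1 + t)) * m t + 2 * β / (α * (1 + t)) * n t + σ ^ 2 / α ^ 2) t)
    (hv : ∀ t, 0 < t → HasDerivAt v
      (-(2 * (α - β / (1 + t))) * v t - 2 * α * β / (1 + t) * n t + σ ^ 2) t)
    (hn : ∀ t, 0 < t → HasDerivAt n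
      (-α * n t - α * β / (1 + t) * m t + β / (α * (1 + t)) * v t + σ ^ 2 / α) t)
    (hm0 : ∀ t, 0 ≤ m t) (hv0 : ∀ t, 0 ≤ v t) (hmv : ∀ t, n t ^ 2 ≤ m t * v t) :
    Tendsto n atTop (nhds (σ ^ 2 * (β + 1) / (α ^ 2 * (2 * β + 1)))) ∧
      ∃ C, ∀ᶠ t in atTop, v t ≤ C := by
  -- linear growth of the total energy
  obtain ⟨A, hA0, hA⟩ : ∃ A, 0 ≤ A ∧ ∀ᶠ t in atTop, m t + v t / α ^ 2 ≤ A * (1 + t) := by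
    set T := max 1 (β / α) with hTdef
    have hT1 : 0 < T := lt_of_lt_of_le one_pos (le_max_left _ _)
    have hanti : AntitoneOn (fun t => m t + v t / α ^ 2 - 2 * σ ^ 2 / α ^ 2 * t) (Ici T) := by
      have hd : ∀ t, 0 < t → HasDerivAt (fun t => m t + v t / α ^ 2 - 2 * σ ^ 2 / α ^ 2 * t)
          (-(2 * β / (1 + t)) * m t - 2 * (α - β / (1 + t)) / α ^ 2 * v t) t := by
        intro t ht
        have h1 : 1 + t ≠ 0 := by positivity
        refine (((hm t ht).add ((hv t ht).div_const (α ^ 2))).sub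
          ((hasDerivAt_id t).const_mul (2 * σ ^ 2 / α ^ 2))).congr_deriv ?_
        field_simp
        ring
      apply antitoneOn_of_hasDerivWithinAt_nonpos (convex_Ici T)
        (f' := fun t => -(2 * β / (1 + t)) * m t - 2 * (α - β / (1 + t)) / α ^ 2 * v t)
      · exact fun t ht => (hd t (hT1.trans_le ht)).continuousAt.continuousWithinAt
      · intro t ht
        rw [interior_Ici, mem_Ioi] at ht
        exact (hd t (hT1.trans ht)).hasDerivWithinAt
      · intro t ht
        rw [interior_Ici, mem_Ioi] at ht
        have h0 : 0 < t := hT1.trans ht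
        have h1 : 0 ≤ 2 * β / (1 + t) * m t := mul_nonneg (by positivity) (hm0 t)
        have h2 : 0 ≤ α - β / (1 + t) := by
          rw [sub_nonneg, div_le_iff₀ (by positivity)]
          have : β / α < t := (le_max_right _ _).trans_lt ht
          rw [div_lt_iff₀ hα] at this
          linarith
        have h3 : 0 ≤ 2 * (α - β / (1 + t)) / α ^ 2 * v t := mul_nonneg (by positivity) (hv0 t)
        linarith
    refine ⟨|m T + v T / α ^ 2 - 2 * σ ^ 2 / α ^ 2 * T| + 2 * σ ^ 2 / α ^ 2, by positivity, ?_⟩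
    filter_upwards [eventually_ge_atTop T] with t ht
    have h1 := hanti (mem_Ici.2 le_rfl) (mem_Ici.2 ht) ht
    simp only at h1
    have h2 := le_abs_self (m T + v T / α ^ 2 - 2 * σ ^ 2 / α ^ 2 * T)
    have h3 : 0 ≤ |m T + v T / α ^ 2 - 2 * σ ^ 2 / α ^ 2 * T| * t :=
      mul_nonneg (abs_nonneg _) (hT1.le.trans ht)
    have h4 : 0 ≤ 2 * σ ^ 2 / α ^ 2 := by positivity
    nlinarith
  have hm_le : ∀ᶠ t in atTop, m t ≤ A * (1 + t) := by
    filter_upwards [hA] with t ht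
    have : 0 ≤ v t / α ^ 2 := div_nonneg (hv0 t) (by positivity)
    linarith
  have hv_le : ∀ᶠ t in atTop, v t ≤ A * α ^ 2 * (1 + t) := by
    filter_upwards [hA] with t ht
    have h1 : v t / α ^ 2 ≤ A * (1 + t) := by linarith [hm0 t]
    rw [div_le_iff₀ (by positivity)] at h1
    linarith
  have hn_le : ∀ᶠ t in atTop, |n t| ≤ A * α * (1 + t) := by
    filter_upwards [hm_le, hv_le, eventually_gt_atTop 0] with t h1 h2 h0
    apply abs_le_of_sq_le_sq _ (by positivity)
    calc n t ^ 2 ≤ m t * v t := hmv t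
      _ ≤ (A * (1 + t)) * (A * α ^ 2 * (1 + t)) :=
        mul_le_mul h1 h2 (hv0 t) (by positivity)
      _ = _ := by ring
  obtain ⟨C, hC⟩ : ∃ C, ∀ᶠ t in atTop, v t ≤ C := by
    set G := 2 * β * (A * α ^ 2) + 2 * α * β * (A * α) + σ ^ 2 with hG
    refine ⟨G / (2 * α) + 1, ?_⟩
    have := eventually_lt_of_hasDerivAt_mul_sub (f := v) (φ := id) (φ' := fun _ => 1)
      (g := fun t => 2 * β / (1 + t) * v t - 2 * α * β / (1 + t) * n t + σ ^ 2) (k := 2 * α)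
      (g₀ := G) (ε := 1) (by positivity) (fun t ht => by convert hv t ht using 1; ring)
      (fun t _ => hasDerivAt_id t) (fun _ _ => zero_le_one) tendsto_id
      (fun δ hδ => by
        filter_upwards [hv_le, hn_le, eventually_gt_atTop 0] with t h1 h2 h0
        have e1 : 2 * β / (1 + t) * v t ≤ 2 * β * (A * α ^ 2) := by
          rw [div_mul_eq_mul_div, div_le_iff₀ (by positivity)]
          nlinarith
        have e2 : -(2 * α * β / (1 + t) * n t) ≤ 2 * α * β * (A * α) := by
          rw [div_mul_eq_mul_div, ← neg_div, div_le_iff₀ (by positivity)]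
          have := neg_abs_le (n t)
          have h5 : 0 < α * β := by positivity
          nlinarith
        simp only [hG]
        linarith) one_pos
    exact this.mono fun t ht => ht.le
  have hτ : Tendsto (fun t : ℝ => 1 + t) atTop atTop := tendsto_atTop_add_const_left _ 1 tendsto_id
  have hinv : Tendsto (fun t : ℝ => (1 + t)⁻¹) atTop (nhds 0) := tendsto_inv_atTop_zero.comp hτ
  have hnτ : Tendsto (fun t => n t * (1 + t)⁻¹) atTop (nhds 0) := by
    have hs : Tendsto (fun t => √(A * |C| * (1 + t)⁻¹)) atTop (nhds 0) := by
      have := (hinv.const_mul (A * |C|)).sqrt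
      simpa using this
    apply squeeze_zero_norm' _ hs
    filter_upwards [hm_le, hC, eventually_gt_atTop 0] with t h1 h2 h0
    apply Real.le_sqrt_of_sq_le
    rw [Real.norm_eq_abs, sq_abs, mul_pow]
    have h3 : n t ^ 2 ≤ A * (1 + t) * |C| := (hmv t).trans
      (mul_le_mul h1 (h2.trans (le_abs_self C)) (hv0 t) (by positivity))
    calc n t ^ 2 * (1 + t)⁻¹ ^ 2 ≤ A * (1 + t) * |C| * (1 + t)⁻¹ ^ 2 := by gcongr
      _ = _ := by field_simp
  have hvτ : Tendsto (fun t => v t * (1 + t)⁻¹) atTop (nhds 0) := by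
    have hs := hinv.const_mul C
    rw [mul_zero] at hs
    apply tendsto_of_tendsto_of_tendsto_of_le_of_le' tendsto_const_nhds hs
    · filter_upwards [eventually_gt_atTop 0] with t h0
      exact mul_nonneg (hv0 t) (by positivity)
    · filter_upwards [hC, eventually_gt_atTop 0] with t h1 h0
      gcongr
  have hmτ : Tendsto (fun t => m t * (1 + t)⁻¹) atTop
      (nhds ((2 * β / α * 0 + σ ^ 2 / α ^ 2) / (2 * β + 1))) := by
    apply tendsto_of_hasDerivAt_mul_sub (φ := fun t => Real.log (1 + t))
      (φ' := fun t => (1 + t)⁻¹) (by positivity) _ _ _ (Real.tendsto_log_atTop.comp hτ)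
      ((hnτ.const_mul (2 * β / α)).add_const (σ ^ 2 / α ^ 2))
    · intro t ht
      have h1 : 1 + t ≠ 0 := by positivity
      have h2 : HasDerivAt (fun t : ℝ => (1 + t)⁻¹) (-1 / (1 + t) ^ 2) t :=
        ((hasDerivAt_id t).const_add 1).inv h1
      refine ((hm t ht).mul h2).congr_deriv ?_
      field_simp
      ring
    · intro t ht
      have h1 : 1 + t ≠ 0 := by positivity
      exact (((hasDerivAt_id t).const_add 1).log h1).congr_deriv (one_div _)
    · intro t ht
      positivity
  refine ⟨?_, C, hC⟩
  have := tendsto_of_hasDerivAt_mul_sub (f := n) (φ := id) (φ' := fun _ => 1) (k := α)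
      (g := fun t => -(α * β) * (m t * (1 + t)⁻¹) + β / α * (v t * (1 + t)⁻¹) + σ ^ 2 / α) hα
      (fun t ht => by
        have h1 : 1 + t ≠ 0 := by positivity
        convert hn t ht using 1
        field_simp
        ring)
      (fun t _ => hasDerivAt_id t) (fun _ _ => zero_le_one) tendsto_id
      (((hmτ.const_mul (-(α * β))).add (hvτ.const_mul (β / α))).add_const (σ ^ 2 / α))
  convert this using 2
  field_simp
  ring

/-- Conservation, up to a relative error `O(1 / t₀)`, of the slow component `y` of the planar
system satisfied by the rescaled correlations. -/
theorem abs_limit_add_le {α β : ℝ} (hα : 0 < α) (hβ : 0 < β) {y z : ℝ → ℝ} {t₀ c S : ℝ}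
    (ht₀ : 0 ≤ t₀) (hαβ : 2 * β ≤ α * (1 + t₀))
    (hyc : ContinuousOn y (Ici t₀)) (hzc : ContinuousOn z (Ici t₀))
    (hy : ∀ t, t₀ < t → HasDerivAt y (β / (α * (1 + t)) * z t) t)
    (hz : ∀ t, t₀ < t → HasDerivAt z
      (-(α - 2 * β / (1 + t)) * z t - α * β / (1 + t) * y t) t)
    (hc : Tendsto (fun t => (1 + t) * z t) atTop (nhds c))
    (hS0 : 0 ≤ S) (hS : y t₀ ^ 2 + z t₀ ^ 2 / α ^ 2 ≤ S ^ 2) :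
    |c / β + y t₀| ≤ (β / α * (|2 * β - 1| + β) + β / α) * S / (1 + t₀) := by
  have hE : AntitoneOn (fun t => y t ^ 2 + z t ^ 2 / α ^ 2) (Ici t₀) := by
    apply antitoneOn_of_hasDerivWithinAt_nonpos (convex_Ici t₀)
      (f' := fun t => -(2 / α ^ 2 * (α - 2 * β / (1 + t)) * z t ^ 2))
    · fun_prop
    · intro t ht
      rw [interior_Ici, mem_Ioi] at ht
      have h1 : 1 + t ≠ 0 := by linarith
      refine HasDerivAt.hasDerivWithinAt ?_
      refine (((hy t ht).pow 2).add (((hz t ht).pow 2).div_const (α ^ 2))).congr_deriv ?_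
      simp only [Nat.cast_ofNat, Nat.add_one_sub_one, pow_one]
      field_simp
      ring
    · intro t ht
      rw [interior_Ici, mem_Ioi] at ht
      have h1 : 0 < 1 + t := by linarith
      have h2 : 0 ≤ α - 2 * β / (1 + t) := by
        rw [sub_nonneg, div_le_iff₀ h1]
        nlinarith
      have : 0 ≤ 2 / α ^ 2 * (α - 2 * β / (1 + t)) * z t ^ 2 := by positivity
      linarith
  have hEle : ∀ t, t₀ ≤ t → y t ^ 2 + z t ^ 2 / α ^ 2 ≤ S ^ 2 := fun t ht =>
    (hE (mem_Ici.2 le_rfl) (mem_Ici.2 ht) ht).trans hS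
  have hyS : ∀ t, t₀ ≤ t → |y t| ≤ S := fun t ht => by
    apply abs_le_of_sq_le_sq _ hS0
    have : 0 ≤ z t ^ 2 / α ^ 2 := by positivity
    linarith [hEle t ht]
  have hzS : ∀ t, t₀ ≤ t → |z t| ≤ α * S := fun t ht => by
    apply abs_le_of_sq_le_sq _ (by positivity)
    have h1 : z t ^ 2 / α ^ 2 ≤ S ^ 2 := by linarith [hEle t ht, sq_nonneg (y t)]
    rw [div_le_iff₀ (by positivity)] at h1
    linarith [mul_pow α S 2]
  set K := β / α * (|2 * β - 1| + β) * S with hK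
  have hK0 : 0 ≤ K := by positivity
  set Y : ℝ → ℝ := fun t => y t + β / α ^ 2 * (z t * (1 + t)⁻¹) with hYdef
  have hinvd : ∀ t, t₀ < t → HasDerivAt (fun t : ℝ => (1 + t)⁻¹) (-1 / (1 + t) ^ 2) t := by
    intro t ht
    have h1 : 1 + t ≠ 0 := by linarith
    exact ((hasDerivAt_id t).const_add 1).inv h1
  have hinvc : ContinuousOn (fun t : ℝ => (1 + t)⁻¹) (Ici t₀) := by
    apply ContinuousOn.inv₀ (by fun_prop)
    intro t ht
    have : t₀ ≤ t := ht
    linarith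
  have hYc : ContinuousOn Y (Ici t₀) := hyc.add ((hzc.mul hinvc).const_smul (β / α ^ 2))
  have hYd : ∀ t, t₀ < t → HasDerivAt Y
      (β / α ^ 2 * ((2 * β - 1) * z t - α * β * y t) / (1 + t) ^ 2) t := by
    intro t ht
    have h1 : 1 + t ≠ 0 := by linarith
    refine ((hy t ht).add (((hz t ht).mul (hinvd t ht)).const_mul (β / α ^ 2))).congr_deriv ?_
    field_simp
    ring
  have hYb : ∀ t, t₀ < t → |β / α ^ 2 * ((2 * β - 1) * z t - α * β * y t)| ≤ K := by
    intro t ht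
    rw [abs_mul, abs_of_pos (by positivity : 0 < β / α ^ 2)]
    have h1 : |(2 * β - 1) * z t - α * β * y t| ≤ |2 * β - 1| * (α * S) + α * β * S := by
      refine (abs_sub _ _).trans ?_
      rw [abs_mul, abs_mul (α * β), abs_of_pos (by positivity : 0 < α * β)]
      gcongr
      · exact hzS t ht.le
      · exact hyS t ht.le
    calc β / α ^ 2 * |(2 * β - 1) * z t - α * β * y t|
        ≤ β / α ^ 2 * (|2 * β - 1| * (α * S) + α * β * S) := by gcongr
      _ = K := by rw [hK]; field_simp
  have hanti : AntitoneOn (fun t => Y t + K * (1 + t)⁻¹) (Ici t₀) := by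
    apply antitoneOn_of_hasDerivWithinAt_nonpos (convex_Ici t₀)
      (f' := fun t => β / α ^ 2 * ((2 * β - 1) * z t - α * β * y t) / (1 + t) ^ 2
        + K * (-1 / (1 + t) ^ 2))
    · exact hYc.add (hinvc.const_smul K)
    · intro t ht
      rw [interior_Ici, mem_Ioi] at ht
      exact ((hYd t ht).add ((hinvd t ht).const_mul K)).hasDerivWithinAt
    · intro t ht
      rw [interior_Ici, mem_Ioi] at ht
      rw [← mul_div_assoc, ← add_div]
      apply div_nonpos_of_nonpos_of_nonneg _ (by positivity)
      linarith [(abs_le.1 (hYb t ht)).2]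
  have hmono : MonotoneOn (fun t => Y t - K * (1 + t)⁻¹) (Ici t₀) := by
    apply monotoneOn_of_hasDerivWithinAt_nonneg (convex_Ici t₀)
      (f' := fun t => β / α ^ 2 * ((2 * β - 1) * z t - α * β * y t) / (1 + t) ^ 2
        - K * (-1 / (1 + t) ^ 2))
    · exact hYc.sub (hinvc.const_smul K)
    · intro t ht
      rw [interior_Ici, mem_Ioi] at ht
      exact ((hYd t ht).sub ((hinvd t ht).const_mul K)).hasDerivWithinAt
    · intro t ht
      rw [interior_Ici, mem_Ioi] at ht
      rw [← mul_div_assoc, ← sub_div]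
      apply div_nonneg _ (by positivity)
      linarith [(abs_le.1 (hYb t ht)).1]
  have hYclose : ∀ t, t₀ ≤ t → |Y t - Y t₀| ≤ K * (1 + t₀)⁻¹ := by
    intro t ht
    have h1 := hanti (mem_Ici.2 le_rfl) (mem_Ici.2 ht) ht
    have h2 := hmono (mem_Ici.2 le_rfl) (mem_Ici.2 ht) ht
    have h3 : 0 ≤ K * (1 + t)⁻¹ := mul_nonneg hK0 (inv_nonneg.2 (by linarith))
    simp only at h1 h2
    rw [abs_le]
    constructor <;> linarith
  have hτ : Tendsto (fun t : ℝ => 1 + t) atTop atTop := tendsto_atTop_add_const_left _ 1 tendsto_id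
  have hinv : Tendsto (fun t : ℝ => (1 + t)⁻¹) atTop (nhds 0) := tendsto_inv_atTop_zero.comp hτ
  obtain ⟨l, hl⟩ : ∃ l, Tendsto Y atTop (nhds l) := by
    have hA : Antitone (fun t => Y (max t t₀) + K * (1 + max t t₀)⁻¹) := fun s t hst =>
      hanti (mem_Ici.2 (le_max_right _ _)) (mem_Ici.2 (le_max_right _ _))
        (max_le_max_right t₀ hst)
    have hbdd : BddBelow (range fun t => Y (max t t₀) + K * (1 + max t t₀)⁻¹) := by
      refine ⟨Y t₀ - K * (1 + t₀)⁻¹, ?_⟩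
      rintro _ ⟨t, rfl⟩
      have h1 := (abs_le.1 (hYclose (max t t₀) (le_max_right _ _))).1
      have h3 : 0 ≤ K * (1 + max t t₀)⁻¹ :=
        mul_nonneg hK0 (inv_nonneg.2 (by linarith [le_max_right t t₀]))
      simp only
      linarith
    have h1 := tendsto_atTop_ciInf hA hbdd
    refine ⟨_, (h1.sub (hinv.const_mul K)).congr' ?_⟩
    filter_upwards [eventually_ge_atTop t₀] with t ht
    rw [max_eq_left ht]
    ring
  have hz0 : Tendsto z atTop (nhds 0) := by
    have := hinv.mul hc
    rw [zero_mul] at this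
    refine this.congr' ?_
    filter_upwards [eventually_ge_atTop t₀] with t ht
    have h1 : 1 + t ≠ 0 := by linarith
    field_simp
  have hyl : Tendsto y atTop (nhds l) := by
    have h2 := hl.sub ((hz0.mul hinv).const_mul (β / α ^ 2))
    simp only [mul_zero, sub_zero] at h2
    refine h2.congr fun t => ?_
    simp only [hYdef]
    ring
  have hcl : c = -β * l := by
    have hsh : Tendsto (fun t : ℝ => t₀ + t) atTop atTop :=
      tendsto_atTop_add_const_left _ t₀ tendsto_id
    have h1 := tendsto_of_hasDerivAt_mul_sub (f := fun t => (1 + (t₀ + t)) * z (t₀ + t)) (φ := id)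
      (φ' := fun _ => 1) (k := α)
      (g := fun t => (2 * β + 1) * z (t₀ + t) - α * β * y (t₀ + t)) hα
      (fun t ht => by
        have h1 : 1 + (t₀ + t) ≠ 0 := by positivity
        have h2 : HasDerivAt (fun s => (1 + s) * z s) _ (t₀ + t) :=
          ((hasDerivAt_id (t₀ + t)).const_add 1).mul (hz (t₀ + t) (by linarith))
        refine (h2.comp_const_add t₀ t).congr_deriv ?_
        simp only [id]
        field_simp
        ring)
      (fun t _ => hasDerivAt_id t) (fun _ _ => zero_le_one) tendsto_id
      (((hz0.comp hsh).const_mul (2 * β + 1)).sub ((hyl.comp hsh).const_mul (α * β)))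
    rw [tendsto_nhds_unique (hc.comp hsh) h1]
    field_simp
    ring
  have hlY : |l - Y t₀| ≤ K * (1 + t₀)⁻¹ :=
    le_of_tendsto (hl.sub_const _).abs ((eventually_ge_atTop t₀).mono hYclose)
  have hyY : |Y t₀ - y t₀| ≤ β / α * S * (1 + t₀)⁻¹ := by
    simp only [hYdef, add_sub_cancel_left]
    have h1 : 0 < (1 + t₀)⁻¹ := by positivity
    rw [abs_mul, abs_mul, abs_of_pos h1, abs_of_pos (by positivity : 0 < β / α ^ 2)]
    calc β / α ^ 2 * (|z t₀| * (1 + t₀)⁻¹) ≤ β / α ^ 2 * (α * S * (1 + t₀)⁻¹) := by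
          gcongr
          exact hzS t₀ le_rfl
      _ = _ := by field_simp
  have e : c / β + y t₀ = -((l - Y t₀) + (Y t₀ - y t₀)) := by
    rw [hcl]; field_simp; ring
  rw [e, abs_neg]
  refine (abs_add_le _ _).trans ((add_le_add hlY hyY).trans (le_of_eq ?_))
  rw [hK]; field_simp

section Hilbert

variable {H : Type*} [NormedAddCommGroup H]

local notation "⟪" x ", " y "⟫" => inner ℝ x y

/-- `W` has the covariance structure of a Brownian motion on `[0, ∞)`. -/
structure IsHilbertBrownian (W : ℝ → H) : Prop where
  zero : W 0 = 0
  norm_sub_sq : ∀ s t, 0 ≤ s → s ≤ t → ‖W t - W s‖ ^ 2 = t - s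

namespace IsHilbertBrownian

variable {W : ℝ → H}

theorem norm_sq (hW : IsHilbertBrownian W) {t : ℝ} (ht : 0 ≤ t) : ‖W t‖ ^ 2 = t := by
  simpa [hW.zero] using hW.norm_sub_sq 0 t le_rfl ht

theorem norm_sub_eq (hW : IsHilbertBrownian W) {s t : ℝ} (hs : 0 ≤ s) (ht : 0 ≤ t) :
    ‖W t - W s‖ = √|t - s| := by
  rcases le_total s t with h | h
  · rw [abs_of_nonneg (sub_nonneg.2 h), ← hW.norm_sub_sq s t hs h, Real.sqrt_sq (norm_nonneg _)]
  · rw [abs_of_nonpos (sub_nonpos.2 h), neg_sub, ← hW.norm_sub_sq t s ht h,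
      Real.sqrt_sq (norm_nonneg _), norm_sub_rev]

theorem continuousOn (hW : IsHilbertBrownian W) : ContinuousOn W (Ici 0) := by
  intro t ht
  rw [ContinuousWithinAt, tendsto_iff_norm_sub_tendsto_zero]
  have h1 : Tendsto (fun s => √|s - t|) (nhdsWithin t (Ici 0)) (nhds 0) := by
    have h2 : Continuous fun s => √|s - t| := by fun_prop
    simpa using (h2.tendsto t).mono_left nhdsWithin_le_nhds
  refine h1.congr' ?_
  filter_upwards [self_mem_nhdsWithin] with s hs
  rw [hW.norm_sub_eq ht hs]

theorem continuousAt (hW : IsHilbertBrownian W) {t : ℝ} (ht : 0 < t) : ContinuousAt W t :=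
  hW.continuousOn.continuousAt (Ici_mem_nhds ht)

variable [InnerProductSpace ℝ H]

theorem inner_sub_eq_zero (hW : IsHilbertBrownian W) {s t : ℝ} (hs : 0 ≤ s) (hst : s ≤ t) :
    ⟪W s, W t - W s⟫ = 0 := by
  have h1 := norm_add_sq_real (W s) (W t - W s)
  rw [add_sub_cancel, hW.norm_sq hs, hW.norm_sq (hs.trans hst), hW.norm_sub_sq s t hs hst] at h1
  linarith

theorem hasDerivAt_inner_of_adapted (hW : IsHilbertBrownian W) {U : ℝ → H} {A : H} {t : ℝ}
    (ht : 0 < t) (hU : HasDerivAt U A t)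
    (hUW : ∀ s r, 0 ≤ s → s ≤ r → ⟪U s, W r - W s⟫ = 0) :
    HasDerivAt (fun s => ⟪U s, W s⟫) ⟪A, W t⟫ t := by
  rw [hasDerivAt_iff_tendsto_slope] at hU ⊢
  have hmax : Tendsto (fun s => W (max s t)) (nhdsWithin t {t}ᶜ) (nhds (W t)) := by
    have h1 : Tendsto (fun s => max s t) (nhds t) (nhds t) := by
      have h2 : Continuous fun s => max s t := by fun_prop
      simpa using h2.tendsto t
    exact ((hW.continuousAt ht).tendsto.comp h1).mono_left nhdsWithin_le_nhds
  refine (hU.inner hmax).congr' ?_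
  filter_upwards [nhdsWithin_le_nhds (Ioi_mem_nhds ht)] with s hs
  have hs' : 0 ≤ s := le_of_lt hs
  simp only [slope, vsub_eq_sub, inner_smul_left, smul_eq_mul, RCLike.conj_to_real]
  congr 1
  rcases le_total s t with h | h
  · have h1 := hUW s t hs' h
    rw [max_eq_right h]
    rw [inner_sub_right] at h1
    rw [inner_sub_left]
    linarith
  · have h1 := hUW t s ht.le h
    rw [max_eq_left h]
    rw [inner_sub_right] at h1
    rw [inner_sub_left]
    linarith

theorem hasDerivAt_inner_add (hW : IsHilbertBrownian W) {U V : ℝ → H} {A C : H} {t κ l : ℝ}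
    (ht : 0 < t) (hU : HasDerivAt U A t) (hV : HasDerivAt V C t)
    (hUW : ∀ s r, 0 ≤ s → s ≤ r → ⟪U s, W r - W s⟫ = 0)
    (hVW : ∀ s r, 0 ≤ s → s ≤ r → ⟪V s, W r - W s⟫ = 0) :
    HasDerivAt (fun s => ⟪U s + κ • W s, V s + l • W s⟫)
      (⟪A, V t + l • W t⟫ + ⟪C, U t + κ • W t⟫ + κ * l) t := by
  have h1 := hU.inner ℝ hV
  have h2 := (hW.hasDerivAt_inner_of_adapted ht hU hUW).const_mul l
  have h3 := (hW.hasDerivAt_inner_of_adapted ht hV hVW).const_mul κ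
  have h4 := (hasDerivAt_id t).const_mul (κ * l)
  refine ((((h1.add h2).add h3).add h4).congr_deriv ?_).congr_of_eventuallyEq ?_
  · simp only [inner_add_right, inner_smul_right, real_inner_comm C (U t)]
    ring
  · filter_upwards [Ioi_mem_nhds ht] with s hs
    have h5 := hW.norm_sq (le_of_lt hs)
    rw [← real_inner_self_eq_norm_sq] at h5
    simp only [Pi.add_apply, inner_add_left, inner_add_right, inner_smul_right, inner_smul_left,
      RCLike.conj_to_real, h5, real_inner_comm (V s) (W s), id]
    ring

end IsHilbertBrownian

/-- Asymptotics of the two-time correlations of an `H`-valued solution of the affine functional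
differential equation with noise `σ W`. -/
theorem hilbert_correlation_asymptotics [InnerProductSpace ℝ H] [CompleteSpace H]
    {α β σ : ℝ} (hα : 0 < α) (hβ : 0 < β) {W x : ℝ → H} (hW : IsHilbertBrownian W) (hx : Continuous x)
    (hxW : ∀ s t, 0 ≤ s → s ≤ t → ⟪x s, W t - W s⟫ = 0)
    (heq : ∀ t, 0 ≤ t → x t =
      (∫ s in (0 : ℝ)..t, (-α • x s - (α * β / (1 + s)) • ∫ u in (0 : ℝ)..s, x u)) + σ • W t)
    {c : ℝ → ℝ}
    (hc : ∀ t, 0 ≤ t → Tendsto (fun Δ : ℝ => Δ ^ (1 + β) * ⟪x t, x (t + Δ)⟫) atTop (nhds (c t))) :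
    Tendsto (fun t => c t / t ^ β) atTop
      (nhds (-(β * (σ ^ 2 * (β + 1) / (α ^ 2 * (2 * β + 1)))))) := by
  set i : ℝ → H := fun t => ∫ s in (0 : ℝ)..t, x s with hi
  set D : ℝ → H := fun t => -α • x t - (α * β / (1 + t)) • i t with hD
  set Z : ℝ → H := fun t => ∫ s in (0 : ℝ)..t, D s with hZ
  have hid : ∀ t, HasDerivAt i (x t) t := fun t => hx.integral_hasStrictDerivAt 0 t |>.hasDerivAt
  have hic : Continuous i := continuous_iff_continuousAt.2 fun t => (hid t).continuousAt
  have hDc : ContinuousOn D (Ici 0) := by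
    have : ContinuousOn (fun t : ℝ => α * β / (1 + t)) (Ici 0) := by
      apply ContinuousOn.div (by fun_prop) (by fun_prop)
      intro t ht
      have : 0 ≤ t := ht
      positivity
    fun_prop
  have hZd : ∀ t, 0 < t → HasDerivAt Z (D t) t := by
    intro t ht
    apply intervalIntegral.integral_hasDerivAt_right
    · apply ContinuousOn.intervalIntegrable
      rw [uIcc_of_le ht.le]
      exact hDc.mono Icc_subset_Ici_self
    · exact (hDc.mono Ioi_subset_Ici_self).stronglyMeasurableAtFilter isOpen_Ioi t ht
    · exact hDc.continuousAt (Ici_mem_nhds ht)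
  have hxZ : ∀ t, 0 ≤ t → x t = Z t + σ • W t := heq
  have hZW : ∀ s t, 0 ≤ s → s ≤ t → ⟪Z s, W t - W s⟫ = 0 := by
    intro s t hs hst
    have h1 : Z s = x s - σ • W s := by rw [hxZ s hs]; abel
    rw [h1, inner_sub_left, inner_smul_left, hxW s t hs hst, hW.inner_sub_eq_zero hs hst]
    simp
  have hiW : ∀ s t, 0 ≤ s → s ≤ t → ⟪i s, W t - W s⟫ = 0 := by
    intro s t hs hst
    have h1 := (innerSL ℝ (W t - W s)).intervalIntegral_comp_comm
      (hx.intervalIntegrable (μ := volume) 0 s)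
    rw [real_inner_comm]
    simp only [innerSL_apply_apply] at h1
    rw [hi, ← h1]
    apply intervalIntegral.integral_zero_ae
    filter_upwards with u hu
    rw [uIoc_of_le hs] at hu
    have h2 := hxW u t hu.1.le (hu.2.trans hst)
    have h3 := hxW u s hu.1.le hu.2
    rw [inner_sub_right] at h2 h3
    rw [real_inner_comm, inner_sub_right]
    linarith
  set M : ℝ → H := fun t => i t + α⁻¹ • x t with hM
  set U : ℝ → H := fun t => i t + α⁻¹ • Z t with hU
  have hUd : ∀ t, 0 < t → HasDerivAt U (x t + α⁻¹ • D t) t := fun t ht =>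
    (hid t).add ((hZd t ht).const_smul α⁻¹)
  have hUW : ∀ s t, 0 ≤ s → s ≤ t → ⟪U s, W t - W s⟫ = 0 := by
    intro s t hs hst
    simp only [hU, inner_add_left, inner_smul_left, hiW s t hs hst, hZW s t hs hst]
    simp
  have hMU : ∀ t, 0 ≤ t → M t = U t + (σ / α) • W t := by
    intro t ht
    simp only [hM, hU]
    rw [hxZ t ht, smul_add, smul_smul, add_assoc, div_eq_inv_mul]
  have hiM : ∀ t, i t = M t - α⁻¹ • x t := fun t => by simp [hM]
  have hUd_eq : ∀ t, 0 < t →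
      x t + α⁻¹ • D t = -(β / (1 + t)) • M t + (β / (α * (1 + t))) • x t := by
    intro t ht
    simp only [hD, hiM t]
    match_scalars <;> field_simp
    ring
  have hD_eq : ∀ t, 0 < t → D t = -(α - β / (1 + t)) • x t - (α * β / (1 + t)) • M t := by
    intro t ht
    simp only [hD, hiM t]
    match_scalars <;> field_simp
    ring
  -- equal-time second moments
  have hmd : ∀ t, 0 < t → HasDerivAt (fun t => ⟪M t, M t⟫)
      (-(2 * β / (1 + t)) * ⟪M t, M t⟫ + 2 * β / (α * (1 + t)) * ⟪M t, x t⟫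
        + σ ^ 2 / α ^ 2) t := by
    intro t ht
    refine ((hW.hasDerivAt_inner_add (κ := σ / α) (l := σ / α) ht (hUd t ht) (hUd t ht)
      hUW hUW).congr_deriv ?_).congr_of_eventuallyEq ?_
    · rw [← hMU t ht.le, hUd_eq t ht]
      simp only [inner_add_left, inner_smul_left, RCLike.conj_to_real, real_inner_comm (M t) (x t)]
      field_simp
      ring
    · filter_upwards [Ioi_mem_nhds ht] with s hs
      rw [hMU s (le_of_lt hs)]
  have hvd : ∀ t, 0 < t → HasDerivAt (fun t => ⟪x t, x t⟫)
      (-(2 * (α - β / (1 + t))) * ⟪x t, x t⟫ - 2 * α * β / (1 + t) * ⟪M t, x t⟫ + σ ^ 2) t := by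
    intro t ht
    refine ((hW.hasDerivAt_inner_add (κ := σ) (l := σ) ht (hZd t ht) (hZd t ht)
      hZW hZW).congr_deriv ?_).congr_of_eventuallyEq ?_
    · rw [← hxZ t ht.le, hD_eq t ht]
      simp only [inner_sub_left, inner_smul_left, RCLike.conj_to_real]
      field_simp
      ring
    · filter_upwards [Ioi_mem_nhds ht] with s hs
      rw [hxZ s (le_of_lt hs)]
  have hnd : ∀ t, 0 < t → HasDerivAt (fun t => ⟪M t, x t⟫)
      (-α * ⟪M t, x t⟫ - α * β / (1 + t) * ⟪M t, M t⟫ + β / (α * (1 + t)) * ⟪x t, x t⟫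
        + σ ^ 2 / α) t := by
    intro t ht
    refine ((hW.hasDerivAt_inner_add (κ := σ / α) (l := σ) ht (hUd t ht) (hZd t ht)
      hUW hZW).congr_deriv ?_).congr_of_eventuallyEq ?_
    · rw [← hxZ t ht.le, ← hMU t ht.le, hUd_eq t ht, hD_eq t ht]
      simp only [inner_add_left, inner_sub_left, inner_smul_left, RCLike.conj_to_real,
        real_inner_comm (M t) (x t)]
      field_simp
      ring
    · filter_upwards [Ioi_mem_nhds ht] with s hs
      rw [hMU s (le_of_lt hs), hxZ s (le_of_lt hs)]
  obtain ⟨hn, C, hC⟩ := secondMoment_asymptotics (σ := σ) hα hβ hmd hvd hnd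
    (fun t => real_inner_self_nonneg) (fun t => real_inner_self_nonneg)
    (fun t => by
      rw [real_inner_self_eq_norm_sq, real_inner_self_eq_norm_sq, ← mul_pow]
      exact sq_le_sq' (by linarith [neg_le_of_abs_le (abs_real_inner_le_norm (M t) (x t))])
        (real_inner_le_norm _ _))
  -- two-time correlations
  have key : ∀ t, 0 < t → 2 * β ≤ α * (1 + t) →
      |c t / (1 + t) ^ β - -(β * ⟪M t, x t⟫)| ≤
        β * ((β / α * (|2 * β - 1| + β) + β / α) * √(⟪M t, x t⟫ ^ 2 + ⟪x t, x t⟫ ^ 2 / α ^ 2))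
          * (1 + t)⁻¹ := by
    intro t ht hαβ
    have hWc : ∀ s, t ≤ s → ⟪x t, W s⟫ = ⟪x t, W t⟫ := by
      intro s hs
      have := hxW t s ht.le hs
      rw [inner_sub_right] at this
      linarith
    have hpow : ∀ s, t ≤ s → HasDerivAt (fun s : ℝ => (1 + s) ^ β) (β / (1 + s) * (1 + s) ^ β) s := by
      intro s hs
      have h1 : 0 < 1 + s := by linarith
      have h2 := ((hasDerivAt_id s).const_add 1).rpow_const (p := β) (Or.inl h1.ne')
      refine h2.congr_deriv ?_
      simp only [id]
      rw [Real.rpow_sub_one h1.ne']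
      ring
    have hMc : Continuous M := hic.add (hx.const_smul _)
    have hpc : ContinuousOn (fun s : ℝ => (1 + s) ^ β) (Ici t) := fun s hs =>
      (hpow s hs).continuousAt.continuousWithinAt
    have hMd : ∀ s, t < s → HasDerivAt (fun s => ⟪x t, M s⟫)
        (-(β / (1 + s)) * ⟪x t, M s⟫ + β / (α * (1 + s)) * ⟪x t, x s⟫) s := by
      intro s hs
      have h1 := ((hasDerivAt_const s (x t)).inner ℝ (hUd s (ht.trans hs))).add_const
        (σ / α * ⟪x t, W t⟫)
      refine (h1.congr_deriv ?_).congr_of_eventuallyEq ?_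
      · rw [hUd_eq s (ht.trans hs)]
        simp only [inner_add_right, inner_smul_right, inner_zero_left, add_zero]
      · filter_upwards [Ioi_mem_nhds hs] with r hr
        rw [hMU r (ht.le.trans (le_of_lt hr)), inner_add_right, inner_smul_right,
          hWc r (le_of_lt hr)]
    have hxd : ∀ s, t < s → HasDerivAt (fun s => ⟪x t, x s⟫)
        (-(α - β / (1 + s)) * ⟪x t, x s⟫ - α * β / (1 + s) * ⟪x t, M s⟫) s := by
      intro s hs
      have h1 := ((hasDerivAt_const s (x t)).inner ℝ (hZd s (ht.trans hs))).add_const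
        (σ * ⟪x t, W t⟫)
      refine (h1.congr_deriv ?_).congr_of_eventuallyEq ?_
      · rw [hD_eq s (ht.trans hs)]
        simp only [inner_sub_right, inner_smul_right, inner_zero_left, add_zero]
      · filter_upwards [Ioi_mem_nhds hs] with r hr
        rw [hxZ r (ht.le.trans (le_of_lt hr)), inner_add_right, inner_smul_right,
          hWc r (le_of_lt hr)]
    have hlim : Tendsto (fun s => (1 + s) * ((1 + s) ^ β * ⟪x t, x s⟫)) atTop (nhds (c t)) := by
      have h1 : Tendsto (fun s : ℝ => s - t) atTop atTop :=
        tendsto_atTop_add_const_right _ (-t) tendsto_id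
      have h2 := (hc t ht.le).comp h1
      have h3 : Tendsto (fun s : ℝ => (1 + (1 + t) / (s - t)) ^ (1 + β)) atTop
          (nhds ((1 + 0) ^ (1 + β))) := by
        apply Tendsto.rpow_const _ (Or.inr (by positivity))
        exact (h1.const_div_atTop (1 + t)).const_add 1
      have h4 := h3.mul h2
      simp only [add_zero, Real.one_rpow, one_mul] at h4
      refine h4.congr' ?_
      filter_upwards [eventually_gt_atTop t] with s hs
      have h5 : 0 < s - t := sub_pos.2 hs
      have h6 : 0 < 1 + s := by linarith
      have e : 1 + (1 + t) / (s - t) = (1 + s) / (s - t) := by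
        field_simp
        ring
      have h7 : (s - t) ^ (1 + β) ≠ 0 := (Real.rpow_pos_of_pos h5 _).ne'
      rw [e, Real.div_rpow h6.le h5.le, Function.comp_apply, add_sub_cancel,
        Real.rpow_add h6 1 β, Real.rpow_one]
      field_simp
    set p := (1 + t) ^ β with hp
    have hp0 : 0 < p := Real.rpow_pos_of_pos (by linarith) β
    set R := √(⟪M t, x t⟫ ^ 2 + ⟪x t, x t⟫ ^ 2 / α ^ 2) with hR
    have hmain := abs_limit_add_le (y := fun s => (1 + s) ^ β * ⟪x t, M s⟫)
      (z := fun s => (1 + s) ^ β * ⟪x t, x s⟫) (t₀ := t) (c := c t) (S := p * R) hα hβ ht.le hαβ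
      (hpc.mul (continuous_const.inner hMc).continuousOn)
      (hpc.mul (continuous_const.inner hx).continuousOn)
      (fun s hs => by
        have h1 : 1 + s ≠ 0 := by linarith
        refine ((hpow s hs.le).mul (hMd s hs)).congr_deriv ?_
        field_simp
        ring)
      (fun s hs => by
        have h1 : 1 + s ≠ 0 := by linarith
        refine ((hpow s hs.le).mul (hxd s hs)).congr_deriv ?_
        field_simp
        ring)
      hlim (by positivity)
      (by
        rw [mul_pow p R, hR, Real.sq_sqrt (by positivity), real_inner_comm]
        apply le_of_eq
        ring)
    have e : c t / p - -(β * ⟪M t, x t⟫) = β / p * (c t / β + p * ⟪x t, M t⟫) := by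
      rw [real_inner_comm]
      field_simp
      ring
    rw [e, abs_mul, abs_of_pos (by positivity)]
    calc β / p * |c t / β + p * ⟪x t, M t⟫|
        ≤ β / p * ((β / α * (|2 * β - 1| + β) + β / α) * (p * R) / (1 + t)) := by gcongr
      _ = _ := by field_simp
  have hτ : Tendsto (fun t : ℝ => 1 + t) atTop atTop := tendsto_atTop_add_const_left _ 1 tendsto_id
  have hinv : Tendsto (fun t : ℝ => (1 + t)⁻¹) atTop (nhds 0) := tendsto_inv_atTop_zero.comp hτ
  have herr : Tendsto (fun t => c t / (1 + t) ^ β - -(β * ⟪M t, x t⟫)) atTop (nhds 0) := by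
    obtain ⟨N, hN⟩ : ∃ N, ∀ᶠ t in atTop, |⟪M t, x t⟫| ≤ N :=
      ⟨_, hn.abs.eventually_le_const (lt_add_one _)⟩
    have hs := hinv.const_mul
      (β * ((β / α * (|2 * β - 1| + β) + β / α) * √(N ^ 2 + C ^ 2 / α ^ 2)))
    rw [mul_zero] at hs
    apply squeeze_zero_norm' _ hs
    filter_upwards [eventually_gt_atTop 0, hτ.eventually_ge_atTop (2 * β / α), hN, hC]
      with t h1 h2 h3 h4
    rw [div_le_iff₀ hα] at h2
    refine (key t h1 (by linarith)).trans ?_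
    have h5 : ⟪x t, x t⟫ ^ 2 ≤ C ^ 2 := pow_le_pow_left₀ real_inner_self_nonneg h4 2
    have h6 : ⟪M t, x t⟫ ^ 2 ≤ N ^ 2 := by
      rw [← sq_abs]
      exact pow_le_pow_left₀ (abs_nonneg _) h3 2
    gcongr
  have hmain := herr.add (hn.const_mul β).neg
  simp only [sub_add_cancel, zero_add] at hmain
  have hratio : Tendsto (fun t : ℝ => (1 + 1 / t) ^ β) atTop (nhds ((1 + 0) ^ β)) := by
    apply Tendsto.rpow_const _ (Or.inr hβ.le)
    exact (tendsto_id.const_div_atTop 1).const_add 1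
  have h := hmain.mul hratio
  rw [add_zero, Real.one_rpow, mul_one] at h
  refine h.congr' ?_
  filter_upwards [eventually_gt_atTop 0] with t ht
  have h1 : (1 + t) ^ β ≠ 0 := (Real.rpow_pos_of_pos (by linarith) _).ne'
  have h2 : t ^ β ≠ 0 := (Real.rpow_pos_of_pos ht _).ne'
  have e : 1 + 1 / t = (1 + t) / t := by
    field_simp
    ring
  rw [e, Real.div_rpow (by linarith) ht.le]
  field_simp

end Hilbert

/-- A Grönwall estimate for solutions of the perturbed integro-differential equation. -/
theorem exists_forall_abs_le_of_integral_eq (a K p σ : ℝ) {r T : ℝ} {ρ : ℝ → ℝ} (hr : 0 ≤ r)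
    (hT : 0 ≤ T) (hρr : ∀ t, |ρ t| ≤ r) :
    ∃ C, 0 ≤ C ∧ ∀ X W : ℝ → ℝ, Continuous X → Continuous W →
      (∀ t, 0 ≤ t → X t = p + (∫ s in (0 : ℝ)..t, (a * X s + ρ s * (K + ∫ u in (0 : ℝ)..s, X u)))
        + σ * W t) →
      ∀ t ∈ Icc 0 T, |X t| ≤ C * (1 + |W t| + ∫ s in (0 : ℝ)..T, |W s|) := by
  set c := |p| + r * |K| * T with hc
  set L := |a| + r * T with hL
  have hc0 : 0 ≤ c := by positivity
  have hL0 : 0 ≤ L := by positivity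
  refine ⟨c + |σ| + L * (exp (L * T) * (c * T + |σ|)), by positivity, ?_⟩
  intro X W hX hW h t ht
  set J : ℝ → ℝ := fun t => ∫ s in (0 : ℝ)..t, |X s| with hJ
  have hJd : ∀ t, HasDerivAt J |X t| t := fun t =>
    (hX.abs.integral_hasStrictDerivAt 0 t).hasDerivAt
  have hJc : Continuous J := continuous_iff_continuousAt.2 fun t => (hJd t).continuousAt
  have hIc : Continuous (fun s => ∫ u in (0 : ℝ)..s, X u) := continuous_iff_continuousAt.2 fun t =>
    (hX.integral_hasStrictDerivAt 0 t).hasDerivAt.continuousAt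
  have hJm : Monotone J := monotone_of_hasDerivAt_nonneg hJd fun t => abs_nonneg _
  have hJ0 : ∀ t, 0 ≤ t → 0 ≤ J t := fun t ht => by
    have := hJm ht
    simpa [hJ] using this
  have hbound : ∀ t ∈ Icc 0 T, |X t| ≤ c + |σ| * |W t| + L * J t := by
    intro t ht
    have h1 : |∫ s in (0 : ℝ)..t, (a * X s + ρ s * (K + ∫ u in (0 : ℝ)..s, X u))|
        ≤ ∫ s in (0 : ℝ)..t, (|a| * |X s| + r * (|K| + J t)) := by
      rw [← Real.norm_eq_abs]
      apply intervalIntegral.norm_integral_le_of_norm_le ht.1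
      · refine Eventually.of_forall fun s hs => ?_
        have h2 : |∫ u in (0 : ℝ)..s, X u| ≤ J t :=
          (intervalIntegral.abs_integral_le_integral_abs hs.1.le).trans (hJm hs.2)
        rw [Real.norm_eq_abs]
        refine (abs_add_le _ _).trans ?_
        rw [abs_mul, abs_mul]
        gcongr
        · exact hρr s
        · exact (abs_add_le _ _).trans (by gcongr)
      · exact Continuous.intervalIntegrable (by fun_prop) _ _
    have h2 : ∫ s in (0 : ℝ)..t, (|a| * |X s| + r * (|K| + J t))
        = |a| * J t + t * (r * (|K| + J t)) := by
      rw [intervalIntegral.integral_add (Continuous.intervalIntegrable (by fun_prop) _ _)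
        (Continuous.intervalIntegrable (by fun_prop) _ _), intervalIntegral.integral_const_mul,
        intervalIntegral.integral_const]
      simp [hJ]
    have h3 : t * (r * (|K| + J t)) ≤ T * (r * (|K| + J t)) := by
      have := hJ0 t ht.1
      gcongr
      exact ht.2
    rw [h t ht.1]
    refine (abs_add_three _ _ _).trans ?_
    rw [abs_mul]
    rw [h2] at h1
    simp only [hc, hL]
    linarith
  have hF : AntitoneOn (fun t => exp (-(L * t)) * J t - ∫ s in (0 : ℝ)..t, (c + |σ| * |W s|))
      (Icc 0 T) := by
    have hd : ∀ t, HasDerivAt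
        (fun t => exp (-(L * t)) * J t - ∫ s in (0 : ℝ)..t, (c + |σ| * |W s|))
        (exp (-(L * t)) * (|X t| - L * J t) - (c + |σ| * |W t|)) t := by
      intro t
      have h1 : HasDerivAt (fun t => exp (-(L * t))) (exp (-(L * t)) * -L) t := by
        simpa using ((hasDerivAt_id t).const_mul L).neg.exp
      have h2 : Continuous fun s => c + |σ| * |W s| := by fun_prop
      refine ((h1.mul (hJd t)).sub (h2.integral_hasStrictDerivAt 0 t).hasDerivAt).congr_deriv ?_
      ring
    apply antitoneOn_of_hasDerivWithinAt_nonpos (convex_Icc 0 T)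
      (fun t _ => (hd t).continuousAt.continuousWithinAt) (fun t _ => (hd t).hasDerivWithinAt)
    intro t ht
    rw [interior_Icc] at ht
    have h1 := hbound t ⟨ht.1.le, ht.2.le⟩
    have h2 : exp (-(L * t)) ≤ 1 := by
      rw [Real.exp_le_one_iff]
      have := mul_nonneg hL0 ht.1.le
      linarith
    have h3 : 0 ≤ c + |σ| * |W t| := by positivity
    have h4 : exp (-(L * t)) * (|X t| - L * J t) ≤ exp (-(L * t)) * (c + |σ| * |W t|) := by
      gcongr
      linarith
    nlinarith
  set N := ∫ s in (0 : ℝ)..T, |W s| with hN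
  have hN0 : 0 ≤ N := intervalIntegral.integral_nonneg hT fun s _ => abs_nonneg _
  have hJT : J T ≤ exp (L * T) * (c * T + |σ| * N) := by
    have h1 := hF (left_mem_Icc.2 hT) (right_mem_Icc.2 hT) hT
    have h2 : ∫ s in (0 : ℝ)..T, (c + |σ| * |W s|) = c * T + |σ| * N := by
      rw [intervalIntegral.integral_add (Continuous.intervalIntegrable (by fun_prop) _ _)
        (Continuous.intervalIntegrable (by fun_prop) _ _), intervalIntegral.integral_const_mul,
        intervalIntegral.integral_const]
      simp [hN, mul_comm]
    simp only [h2, intervalIntegral.integral_same, hJ, mul_zero, sub_zero, sub_nonpos] at h1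
    rw [exp_neg, inv_mul_le_iff₀ (exp_pos _)] at h1
    exact h1
  have hJt : J t ≤ exp (L * T) * (c * T + |σ| * N) := (hJm ht.2).trans hJT
  refine (hbound t ht).trans ?_
  calc c + |σ| * |W t| + L * J t
      ≤ c + |σ| * |W t| + L * (exp (L * T) * (c * T + |σ| * N)) := by gcongr
    _ ≤ c + |σ| * |W t| + L * (exp (L * T) * (c * T + |σ| * N))
        + (c * (|W t| + N) + |σ| * (1 + N) + L * (exp (L * T) * (c * T * (|W t| + N)))
          + L * (exp (L * T) * (|σ| * (1 + |W t|)))) := le_add_of_nonneg_right (by positivity)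
    _ = _ := by ring

theorem sq_integral_le_mul_integral_sq {f : ℝ → ℝ} (hf : Continuous f) {s t : ℝ} (hst : s ≤ t) :
    (∫ u in s..t, f u) ^ 2 ≤ (t - s) * ∫ u in s..t, f u ^ 2 := by
  rcases hst.eq_or_lt with rfl | hlt
  · simp
  have hpos : 0 < t - s := sub_pos.2 hlt
  set A := (∫ u in s..t, f u) / (t - s) with hA
  have h1 : 0 ≤ ∫ u in s..t, (f u - A) ^ 2 :=
    intervalIntegral.integral_nonneg hst fun u _ => sq_nonneg _
  have h2 : ∫ u in s..t, (f u - A) ^ 2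
      = (∫ u in s..t, f u ^ 2) - 2 * A * (∫ u in s..t, f u) + (t - s) * A ^ 2 := by
    have e : (fun u => (f u - A) ^ 2) = fun u => f u ^ 2 - 2 * A * f u + A ^ 2 := by
      funext u; ring
    rw [e, intervalIntegral.integral_add (Continuous.intervalIntegrable (by fun_prop) _ _)
      (Continuous.intervalIntegrable (by fun_prop) _ _),
      intervalIntegral.integral_sub (Continuous.intervalIntegrable (by fun_prop) _ _)
      (Continuous.intervalIntegrable (by fun_prop) _ _), intervalIntegral.integral_const_mul,
      intervalIntegral.integral_const, smul_eq_mul]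
  have h3 : ∫ u in s..t, f u = A * (t - s) := by rw [hA]; field_simp
  rw [h2, h3] at h1
  rw [h3]
  nlinarith

section LTwo

variable {Ω : Type*} {mΩ : MeasurableSpace Ω}

/-- Continuous measurable processes whose second moments are bounded on compact subsets of
`[0, ∞)`. -/
structure IsLTwoFamily (P : Measure Ω) (V : ℝ → Ω → ℝ) : Prop where
  measurable : ∀ t, Measurable (V t)
  continuous : ∀ ω, Continuous fun t => V t ω
  exists_bound : ∀ T, ∃ C, 0 ≤ C ∧ ∀ t ∈ Icc 0 T,
    Integrable (fun ω => V t ω ^ 2) P ∧ ∫ ω, V t ω ^ 2 ∂P ≤ C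

namespace IsLTwoFamily

variable {P : Measure Ω} {V W : ℝ → Ω → ℝ}

theorem integrable_sq (hV : IsLTwoFamily P V) {t : ℝ} (ht : 0 ≤ t) :
    Integrable (fun ω => V t ω ^ 2) P := by
  obtain ⟨C, -, hC⟩ := hV.exists_bound t
  exact (hC t ⟨ht, le_rfl⟩).1

theorem memLp (hV : IsLTwoFamily P V) {t : ℝ} (ht : 0 ≤ t) : MemLp (V t) 2 P :=
  (memLp_two_iff_integrable_sq (hV.measurable t).aestronglyMeasurable).2 (hV.integrable_sq ht)

theorem measurable_uncurry (hV : IsLTwoFamily P V) :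
    Measurable (fun q : ℝ × Ω => V q.1 q.2) :=
  measurable_uncurry_of_continuous_of_measurable hV.continuous hV.measurable

theorem measurable_integral [SFinite P] (hV : IsLTwoFamily P V) (s t : ℝ) :
    Measurable fun ω => ∫ u in s..t, V u ω := by
  have h : ∀ A : Set ℝ, Measurable fun ω => ∫ u in A, V u ω := fun A =>
    (hV.measurable_uncurry.stronglyMeasurable.integral_prod_left (μ := volume.restrict A)).measurable
  exact (h _).sub (h _)

theorem of_dominated (hWm : ∀ t, Measurable (W t))
    (hWc : ∀ ω, Continuous fun t => W t ω)
    (h : ∀ T, ∃ V, IsLTwoFamily P V ∧ ∃ C, 0 ≤ C ∧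
      ∀ t ∈ Icc 0 T, ∀ᵐ ω ∂P, |W t ω| ≤ C * |V t ω|) :
    IsLTwoFamily P W := by
  refine ⟨hWm, hWc, fun T => ?_⟩
  obtain ⟨V, hV, C, hC0, hC⟩ := h T
  obtain ⟨E, hE0, hE⟩ := hV.exists_bound T
  refine ⟨C ^ 2 * E, by positivity, fun t ht => ?_⟩
  have h1 : ∀ᵐ ω ∂P, W t ω ^ 2 ≤ C ^ 2 * V t ω ^ 2 := by
    filter_upwards [hC t ht] with ω hω
    rw [← sq_abs, ← sq_abs (V t ω), ← mul_pow]
    gcongr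
  have h2 : Integrable (fun ω => C ^ 2 * V t ω ^ 2) P := (hE t ht).1.const_mul _
  have h3 : Integrable (fun ω => W t ω ^ 2) P := by
    refine h2.mono' ((hWm t).pow_const 2).aestronglyMeasurable ?_
    filter_upwards [h1] with ω hω
    rwa [Real.norm_eq_abs, abs_of_nonneg (sq_nonneg _)]
  refine ⟨h3, (integral_mono_ae h3 h2 h1).trans ?_⟩
  rw [integral_const_mul]
  exact mul_le_mul_of_nonneg_left (hE t ht).2 (sq_nonneg _)

theorem add (hV : IsLTwoFamily P V) (hW : IsLTwoFamily P W) :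
    IsLTwoFamily P (fun t ω => V t ω + W t ω) := by
  refine ⟨fun t => (hV.measurable t).add (hW.measurable t),
    fun ω => (hV.continuous ω).add (hW.continuous ω), fun T => ?_⟩
  obtain ⟨C, hC0, hC⟩ := hV.exists_bound T
  obtain ⟨E, hE0, hE⟩ := hW.exists_bound T
  refine ⟨2 * C + 2 * E, by positivity, fun t ht => ?_⟩
  have h0 : ∀ ω, (V t ω + W t ω) ^ 2 ≤ 2 * V t ω ^ 2 + 2 * W t ω ^ 2 := fun ω => by
    nlinarith [sq_nonneg (V t ω - W t ω)]
  have h1 := (hC t ht).1.const_mul 2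
  have h2 := (hE t ht).1.const_mul 2
  have h3 : Integrable (fun ω => (V t ω + W t ω) ^ 2) P := by
    refine (h1.add h2).mono'
      (((hV.measurable t).add (hW.measurable t)).pow_const 2).aestronglyMeasurable ?_
    filter_upwards with ω
    rw [Real.norm_eq_abs, abs_of_nonneg (sq_nonneg _)]
    exact h0 ω
  refine ⟨h3, (integral_mono h3 (h1.add h2) h0).trans ?_⟩
  have h4 := integral_add h1 h2
  simp only [Pi.add_apply, integral_const_mul] at h4 ⊢
  rw [h4]
  linarith [(hC t ht).2, (hE t ht).2]

theorem mul_left (hV : IsLTwoFamily P V) {f : ℝ → ℝ} (hf : Continuous f) :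
    IsLTwoFamily P (fun t ω => f t * V t ω) := by
  refine of_dominated (fun t => (hV.measurable t).const_mul _) (fun ω => hf.mul (hV.continuous ω))
    fun T => ?_
  obtain ⟨C, hC⟩ := isCompact_Icc.exists_bound_of_continuousOn (s := Icc 0 T) hf.continuousOn
  refine ⟨V, hV, |C|, abs_nonneg _, fun t ht => ae_of_all _ fun ω => ?_⟩
  rw [abs_mul]
  exact mul_le_mul_of_nonneg_right ((hC t ht).trans (le_abs_self C)) (abs_nonneg _)

theorem abs (hV : IsLTwoFamily P V) : IsLTwoFamily P (fun t ω => |V t ω|) :=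
  of_dominated (fun t => (hV.measurable t).abs) (fun ω => (hV.continuous ω).abs) fun _ =>
    ⟨V, hV, 1, zero_le_one, fun _ _ => ae_of_all _ fun _ => by rw [abs_abs, one_mul]⟩

theorem frozen (hV : IsLTwoFamily P V) {t : ℝ} (ht : 0 ≤ t) : IsLTwoFamily P (fun _ => V t) :=
  ⟨fun _ => hV.measurable t, fun _ => continuous_const, fun _ =>
    ⟨∫ ω, V t ω ^ 2 ∂P, integral_nonneg fun _ => sq_nonneg _, fun _ _ =>
      ⟨hV.integrable_sq ht, le_rfl⟩⟩⟩

theorem const [IsProbabilityMeasure P] (k : ℝ) : IsLTwoFamily P (fun _ _ => k) :=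
  ⟨fun _ => measurable_const, fun _ => continuous_const, fun _ =>
    ⟨k ^ 2, sq_nonneg k, fun _ _ => ⟨integrable_const _, by simp⟩⟩⟩

theorem integrable_prod_sq [IsFiniteMeasure P] (hV : IsLTwoFamily P V) {s : ℝ} (t : ℝ)
    (hs : 0 ≤ s) :
    Integrable (fun q : ℝ × Ω => V q.1 q.2 ^ 2) ((volume.restrict (Ioc s t)).prod P) := by
  obtain ⟨C, -, hC⟩ := hV.exists_bound t
  have hm := (hV.measurable_uncurry.pow_const 2).stronglyMeasurable
  rw [integrable_prod_iff hm.aestronglyMeasurable]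
  constructor
  · filter_upwards [ae_restrict_mem measurableSet_Ioc] with u hu
    exact (hC u ⟨hs.trans hu.1.le, hu.2⟩).1
  · apply Integrable.of_bound (C := C) hm.norm.integral_prod_right.aestronglyMeasurable
    filter_upwards [ae_restrict_mem measurableSet_Ioc] with u hu
    simp only [norm_pow, Real.norm_eq_abs, sq_abs]
    rw [abs_of_nonneg (integral_nonneg fun ω => sq_nonneg _)]
    exact (hC u ⟨hs.trans hu.1.le, hu.2⟩).2

theorem integral_sq_integral_le [IsFiniteMeasure P] (hV : IsLTwoFamily P V) {s t C : ℝ}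
    (hs : 0 ≤ s) (hst : s ≤ t) (hC : ∀ u ∈ Icc 0 t, ∫ ω, V u ω ^ 2 ∂P ≤ C) :
    Integrable (fun ω => (∫ u in s..t, V u ω) ^ 2) P ∧
      ∫ ω, (∫ u in s..t, V u ω) ^ 2 ∂P ≤ (t - s) ^ 2 * C := by
  have hint := hV.integrable_prod_sq t hs
  have h1 : Integrable (fun ω => (t - s) * ∫ u in s..t, V u ω ^ 2) P := by
    have := hint.integral_prod_right.const_mul (t - s)
    simpa only [intervalIntegral.integral_of_le hst] using this
  have h0 : ∀ ω, (∫ u in s..t, V u ω) ^ 2 ≤ (t - s) * ∫ u in s..t, V u ω ^ 2 := fun ω =>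
    sq_integral_le_mul_integral_sq (hV.continuous ω) hst
  have h2 : Integrable (fun ω => (∫ u in s..t, V u ω) ^ 2) P := by
    refine h1.mono' ((hV.measurable_integral s t).pow_const 2).aestronglyMeasurable ?_
    filter_upwards with ω
    rw [Real.norm_eq_abs, abs_of_nonneg (sq_nonneg _)]
    exact h0 ω
  refine ⟨h2, (integral_mono h2 h1 h0).trans ?_⟩
  rw [integral_const_mul, sq, mul_assoc]
  apply mul_le_mul_of_nonneg_left _ (sub_nonneg.2 hst)
  have hswap : ∫ ω, (∫ u in s..t, V u ω ^ 2) ∂P = ∫ u in s..t, (∫ ω, V u ω ^ 2 ∂P) := by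
    simp only [intervalIntegral.integral_of_le hst]
    exact (integral_integral_swap (f := fun u ω => V u ω ^ 2) hint).symm
  rw [hswap]
  have h3 : IntervalIntegrable (fun u => ∫ ω, V u ω ^ 2 ∂P) volume s t := by
    rw [intervalIntegrable_iff_integrableOn_Ioc_of_le hst]
    exact hint.integral_prod_left
  have h4 := intervalIntegral.integral_mono_on hst h3 (intervalIntegrable_const (c := C))
    fun u hu => hC u ⟨hs.trans hu.1, hu.2⟩
  simpa using h4

theorem primitive [IsFiniteMeasure P] (hV : IsLTwoFamily P V) :
    IsLTwoFamily P (fun t ω => ∫ u in (0 : ℝ)..t, V u ω) := by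
  refine ⟨hV.measurable_integral 0, fun ω => continuous_iff_continuousAt.2 fun t =>
    ((hV.continuous ω).integral_hasStrictDerivAt 0 t).hasDerivAt.continuousAt, fun T => ?_⟩
  obtain ⟨C, hC0, hC⟩ := hV.exists_bound T
  refine ⟨T ^ 2 * C, by positivity, fun t ht => ?_⟩
  obtain ⟨h1, h2⟩ := hV.integral_sq_integral_le le_rfl ht.1
    (fun u hu => (hC u ⟨hu.1, hu.2.trans ht.2⟩).2)
  refine ⟨h1, h2.trans ?_⟩
  rw [sub_zero]
  have := ht.1
  gcongr
  exact ht.2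

theorem integral_mul_integral [IsFiniteMeasure P] (hV : IsLTwoFamily P V) {Y : Ω → ℝ}
    (hY : MemLp Y 2 P) {t : ℝ} (ht : 0 ≤ t) :
    ∫ ω, Y ω * (∫ u in (0 : ℝ)..t, V u ω) ∂P = ∫ u in (0 : ℝ)..t, ∫ ω, Y ω * V u ω ∂P := by
  have h1 := hV.integrable_prod_sq t le_rfl
  have h2 : Integrable (fun q : ℝ × Ω => Y q.2 ^ 2) ((volume.restrict (Ioc 0 t)).prod P) :=
    hY.integrable_sq.comp_snd _
  have h3 : Integrable (fun q : ℝ × Ω => Y q.2 * V q.1 q.2)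
      ((volume.restrict (Ioc 0 t)).prod P) := by
    refine (h2.add h1).mono' (hY.aestronglyMeasurable.comp_snd.mul
      hV.measurable_uncurry.aestronglyMeasurable) (ae_of_all _ fun q => ?_)
    rw [Real.norm_eq_abs, abs_le, Pi.add_apply]
    constructor <;> nlinarith [sq_nonneg (Y q.2 + V q.1 q.2), sq_nonneg (Y q.2 - V q.1 q.2),
      sq_nonneg (Y q.2), sq_nonneg (V q.1 q.2)]
  simp only [intervalIntegral.integral_of_le ht, ← integral_const_mul]
  exact (integral_integral_swap (f := fun u ω => Y ω * V u ω) h3).symm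

/-- The `L²`-valued curve of an `L²` process, frozen at time `0` for negative times. -/
def curve (hV : IsLTwoFamily P V) (t : ℝ) : Lp ℝ 2 P :=
  (hV.memLp (le_max_right t 0)).toLp

theorem coeFn_curve (hV : IsLTwoFamily P V) {t : ℝ} (ht : 0 ≤ t) : hV.curve t =ᵐ[P] V t := by
  have h := (hV.memLp (le_max_right t 0)).coeFn_toLp
  have e : V (max t 0) = V t := by rw [max_eq_left ht]
  exact h.trans (by rw [e])

theorem curve_max (hV : IsLTwoFamily P V) (t : ℝ) : hV.curve (max t 0) = hV.curve t := by
  simp only [curve, max_eq_left (le_max_right t 0)]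

theorem curve_congr (hV : IsLTwoFamily P V) (hW : IsLTwoFamily P W) {t : ℝ} (ht : 0 ≤ t)
    (h : V t =ᵐ[P] W t) : hV.curve t = hW.curve t := by
  rw [← max_eq_left ht] at h
  exact (MemLp.toLp_eq_toLp_iff _ _).2 h

theorem curve_add (hV : IsLTwoFamily P V) (hW : IsLTwoFamily P W) (t : ℝ) :
    (hV.add hW).curve t = hV.curve t + hW.curve t :=
  MemLp.toLp_add _ _

theorem curve_mul_left (hV : IsLTwoFamily P V) {f : ℝ → ℝ} (hf : Continuous f) (t : ℝ) :
    (hV.mul_left hf).curve t = f (max t 0) • hV.curve t :=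
  MemLp.toLp_const_smul (f (max t 0)) (hV.memLp (le_max_right t 0))

theorem curve_const [IsProbabilityMeasure P] (k t : ℝ) :
    (const (P := P) k).curve t = k • (const (P := P) 1).curve 0 := by
  have h := (const (P := P) 1).memLp (le_max_right 0 0)
  exact (MemLp.toLp_congr _ (h.const_smul k) (ae_of_all _ fun ω => by simp)).trans
    (MemLp.toLp_const_smul k h)

theorem inner_curve (hV : IsLTwoFamily P V) (Y : Lp ℝ 2 P) {t : ℝ} (ht : 0 ≤ t) :
    inner ℝ Y (hV.curve t) = ∫ ω, Y ω * V t ω ∂P := by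
  rw [L2.inner_def]
  apply integral_congr_ae
  filter_upwards [hV.coeFn_curve ht] with ω hω
  rw [hω]
  simp [mul_comm]

theorem inner_curve_curve (hV : IsLTwoFamily P V) (hW : IsLTwoFamily P W) {s t : ℝ} (hs : 0 ≤ s)
    (ht : 0 ≤ t) : inner ℝ (hV.curve s) (hW.curve t) = ∫ ω, V s ω * W t ω ∂P := by
  rw [hW.inner_curve _ ht]
  apply integral_congr_ae
  filter_upwards [hV.coeFn_curve hs] with ω hω
  rw [hω]

theorem norm_sub_curve_sq (hV : IsLTwoFamily P V) {s t : ℝ} (hs : 0 ≤ s) (ht : 0 ≤ t) :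
    ‖hV.curve t - hV.curve s‖ ^ 2 = ∫ ω, (V t ω - V s ω) ^ 2 ∂P := by
  rw [← real_inner_self_eq_norm_sq, L2.inner_def]
  apply integral_congr_ae
  filter_upwards [Lp.coeFn_sub (hV.curve t) (hV.curve s), hV.coeFn_curve hs, hV.coeFn_curve ht]
    with ω h1 h2 h3
  rw [h1, Pi.sub_apply, h2, h3]
  simp [sq]

theorem curve_primitive [IsFiniteMeasure P] (hV : IsLTwoFamily P V) (hc : Continuous hV.curve)
    {t : ℝ} (ht : 0 ≤ t) : hV.primitive.curve t = ∫ s in (0 : ℝ)..t, hV.curve s := by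
  apply ext_inner_left ℝ
  intro Y
  have h1 := (innerSL ℝ Y).intervalIntegral_comp_comm (hc.intervalIntegrable (μ := volume) 0 t)
  simp only [innerSL_apply_apply] at h1
  rw [← h1, hV.primitive.inner_curve Y ht, hV.integral_mul_integral (Lp.memLp Y) ht]
  apply intervalIntegral.integral_congr
  intro u hu
  rw [uIcc_of_le ht] at hu
  exact (hV.inner_curve Y hu.1).symm

theorem continuous_curve_primitive [IsFiniteMeasure P] (hV : IsLTwoFamily P V) :
    Continuous hV.primitive.curve := by
  have key : ∀ T, ∃ C, 0 ≤ C ∧ ∀ s t, 0 ≤ s → s ≤ t → t ≤ T →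
      ‖hV.primitive.curve t - hV.primitive.curve s‖ ≤ C * (t - s) := by
    intro T
    obtain ⟨C, hC0, hC⟩ := hV.exists_bound T
    refine ⟨√C, Real.sqrt_nonneg _, fun s t hs hst htT => ?_⟩
    apply (sq_le_sq₀ (norm_nonneg _) (mul_nonneg (Real.sqrt_nonneg _) (sub_nonneg.2 hst))).1
    rw [hV.primitive.norm_sub_curve_sq hs (hs.trans hst), mul_pow, Real.sq_sqrt hC0, mul_comm C]
    have h1 : ∀ ω, (∫ u in (0 : ℝ)..t, V u ω) - (∫ u in (0 : ℝ)..s, V u ω)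
        = ∫ u in s..t, V u ω := fun ω =>
      intervalIntegral.integral_interval_sub_left ((hV.continuous ω).intervalIntegrable _ _)
        ((hV.continuous ω).intervalIntegrable _ _)
    simp only [h1]
    exact (hV.integral_sq_integral_le hs hst
      fun u hu => (hC u ⟨hu.1, hu.2.trans htT⟩).2).2
  have hL : ∀ T, ∃ C, 0 ≤ C ∧ ∀ s t, 0 ≤ s → 0 ≤ t → s ≤ T → t ≤ T →
      ‖hV.primitive.curve t - hV.primitive.curve s‖ ≤ C * |t - s| := by
    intro T
    obtain ⟨C, hC0, hC⟩ := key T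
    refine ⟨C, hC0, fun s t hs ht hsT htT => ?_⟩
    rcases le_total s t with h | h
    · rw [abs_of_nonneg (sub_nonneg.2 h)]
      exact hC s t hs h htT
    · rw [abs_sub_comm, abs_of_nonneg (sub_nonneg.2 h), norm_sub_rev]
      exact hC t s ht h hsT
  rw [continuous_iff_continuousAt]
  intro t
  obtain ⟨C, hC0, hC⟩ := hL (max t 0 + 1)
  rw [ContinuousAt, tendsto_iff_norm_sub_tendsto_zero]
  have hmax : Continuous fun s : ℝ => max s 0 := by fun_prop
  have h0 : Tendsto (fun s => C * |max s 0 - max t 0|) (nhds t) (nhds 0) := by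
    have h1 : Continuous fun s : ℝ => C * |max s 0 - max t 0| := by fun_prop
    simpa using h1.tendsto t
  refine squeeze_zero' (Eventually.of_forall fun s => norm_nonneg _) ?_ h0
  filter_upwards [(hmax.tendsto t).eventually_lt_const (lt_add_one (max t 0))] with s hs
  rw [← curve_max _ s, ← curve_max _ t]
  exact hC _ _ (le_max_right _ _) (le_max_right _ _) (by linarith) hs.le

end IsLTwoFamily

end LTwo

section Diffusion

variable {Ω : Type*} {mΩ : MeasurableSpace Ω} {P : Measure Ω} {F : Filtration ℝ mΩ}
  {B X : ℝ → Ω → ℝ}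

theorem moments_of_map_eq_gaussianReal {Y : Ω → ℝ} {v : NNReal} (hY : Measurable Y)
    (h : P.map Y = gaussianReal 0 v) :
    Integrable (fun ω => Y ω ^ 2) P ∧ ∫ ω, Y ω ^ 2 ∂P = v ∧ ∫ ω, Y ω ∂P = 0 := by
  have hid : MemLp id 2 (gaussianReal 0 v) := memLp_id_gaussianReal 2
  rw [← h] at hid
  have h1 : MemLp Y 2 P := hid.comp_of_map hY.aemeasurable
  have h0 : ∫ ω, Y ω ∂P = 0 := by
    rw [← integral_map (f := fun x => x) hY.aemeasurable aestronglyMeasurable_id, h,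
      integral_id_gaussianReal]
  refine ⟨h1.integrable_sq, ?_, h0⟩
  rw [← integral_map (f := fun x => x ^ 2) hY.aemeasurable
    (measurable_id.pow_const 2).aestronglyMeasurable, h,
    ← variance_id_gaussianReal (μ := 0) (v := v),
    variance_of_integral_eq_zero aemeasurable_id integral_id_gaussianReal]
  rfl

namespace IsStdBrownian

theorem measurable (hB : IsStdBrownian P F B) (t : ℝ) : Measurable (B t) :=
  (hB.1 t).mono (F.le t) le_rfl

theorem moments_sub (hB : IsStdBrownian P F B) {s t : ℝ} (hs : 0 ≤ s) (hst : s ≤ t) :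
    Integrable (fun ω => (B t ω - B s ω) ^ 2) P ∧ ∫ ω, (B t ω - B s ω) ^ 2 ∂P = t - s ∧
      ∫ ω, (B t ω - B s ω) ∂P = 0 := by
  have h := moments_of_map_eq_gaussianReal ((hB.measurable t).sub (hB.measurable s))
    (hB.2.2.2.1 s t hs hst)
  rwa [Real.coe_toNNReal _ (sub_nonneg.2 hst)] at h

theorem moments (hB : IsStdBrownian P F B) {t : ℝ} (ht : 0 ≤ t) :
    Integrable (fun ω => B t ω ^ 2) P ∧ ∫ ω, B t ω ^ 2 ∂P = t ∧ ∫ ω, B t ω ∂P = 0 := by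
  have h := hB.moments_sub le_rfl ht
  simpa only [hB.2.1, sub_zero] using h

theorem isLTwoFamily (hB : IsStdBrownian P F B) : IsLTwoFamily P (fun t => B (max t 0)) := by
  refine ⟨fun t => hB.measurable _, fun ω => (hB.2.2.1 ω).comp (by fun_prop), fun T =>
    ⟨|T|, abs_nonneg T, fun t ht => ?_⟩⟩
  obtain ⟨h1, h2, -⟩ := hB.moments ht.1
  rw [max_eq_left ht.1, h2]
  exact ⟨h1, ht.2.trans (le_abs_self T)⟩

theorem isHilbertBrownian (hB : IsStdBrownian P F B) :
    IsHilbertBrownian hB.isLTwoFamily.curve := by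
  have key : ∀ s t, 0 ≤ s → s ≤ t →
      ‖hB.isLTwoFamily.curve t - hB.isLTwoFamily.curve s‖ ^ 2 = t - s := by
    intro s t hs hst
    rw [hB.isLTwoFamily.norm_sub_curve_sq hs (hs.trans hst), max_eq_left hs,
      max_eq_left (hs.trans hst)]
    exact (hB.moments_sub hs hst).2.1
  refine ⟨?_, key⟩
  rw [Lp.eq_zero_iff_ae_eq_zero]
  refine (hB.isLTwoFamily.coeFn_curve le_rfl).trans (ae_of_all _ fun ω => ?_)
  simp [hB.2.1]

theorem continuous_curve (hB : IsStdBrownian P F B) : Continuous hB.isLTwoFamily.curve := by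
  have h := hB.isHilbertBrownian.continuousOn.comp_continuous
    (f := fun t : ℝ => max t 0) (by fun_prop) fun t => le_max_right t 0
  simpa only [Function.comp_def, IsLTwoFamily.curve_max] using h

end IsStdBrownian

namespace IsSolutionSFDE

variable {a b σ : ℝ} {ψ : ℝ → ℝ}

theorem continuous_path (hX : IsSolutionSFDE P F a b σ ψ B X) (ω : Ω) :
    Continuous fun t => X (max t 0) ω :=
  (hX.2.1 ω).comp_continuous (f := fun t : ℝ => max t 0) (by fun_prop) fun t => le_max_right t 0

theorem measurable (hX : IsSolutionSFDE P F a b σ ψ B X) (t : ℝ) : Measurable (X (max t 0)) :=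
  (hX.1 _ (le_max_right t 0)).measurable.mono (F.le _) le_rfl

theorem ae_eq_integral (hX : IsSolutionSFDE P F a b σ ψ B X) :
    ∀ᵐ ω ∂P, ∀ t : ℝ, 0 ≤ t → X (max t 0) ω = ψ 0
      + (∫ s in (0 : ℝ)..t, (a * X (max s 0) ω + b / (1 + max s 0)
        * ((∫ u in (-1 : ℝ)..0, ψ u) + ∫ u in (0 : ℝ)..s, X (max u 0) ω)))
      + σ * B (max t 0) ω := by
  filter_upwards [hX.2.2] with ω hω t ht
  rw [max_eq_left ht, hω t ht]
  congr 2
  apply intervalIntegral.integral_congr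
  intro s hs
  rw [uIcc_of_le ht] at hs
  have h : ∫ u in (0 : ℝ)..s, X (max u 0) ω = ∫ u in (0 : ℝ)..s, X u ω := by
    apply intervalIntegral.integral_congr
    intro u hu
    rw [uIcc_of_le hs.1] at hu
    simp only [max_eq_left hu.1]
  simp only [h, max_eq_left hs.1]

theorem isLTwoFamily [IsProbabilityMeasure P] (hB : IsStdBrownian P F B)
    (hX : IsSolutionSFDE P F a b σ ψ B X) : IsLTwoFamily P (fun t => X (max t 0)) := by
  refine IsLTwoFamily.of_dominated hX.measurable hX.continuous_path fun T => ?_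
  have hW := hB.isLTwoFamily
  have hT : 0 ≤ max T 0 := le_max_right T 0
  have hρ : ∀ t : ℝ, |b / (1 + max t 0)| ≤ |b| := fun t => by
    rw [abs_div]
    refine div_le_self (abs_nonneg b) ?_
    have := le_max_right t 0
    rw [abs_of_nonneg (by linarith)]
    linarith
  obtain ⟨C, hC0, hC⟩ := exists_forall_abs_le_of_integral_eq a (∫ u in (-1 : ℝ)..0, ψ u) (ψ 0) σ
    (abs_nonneg b) hT hρ
  refine ⟨_, ((IsLTwoFamily.const 1).add hW.abs).add (hW.abs.primitive.frozen hT), C, hC0,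
    fun t ht => ?_⟩
  filter_upwards [hX.ae_eq_integral] with ω hω
  have h := hC _ _ (hX.continuous_path ω) (hW.continuous ω) hω t ⟨ht.1, ht.2.trans (le_max_left T 0)⟩
  refine h.trans ?_
  gcongr
  exact le_abs_self _

theorem integral_mul_sub_eq_zero (hB : IsStdBrownian P F B)
    (hX : IsSolutionSFDE P F a b σ ψ B X) {s t : ℝ} (hs : 0 ≤ s) (hst : s ≤ t) :
    ∫ ω, X s ω * (B t ω - B s ω) ∂P = 0 := by
  have hm : Measurable[F s] (X s) := (hX.1 s hs).measurable
  have hind : IndepFun (fun ω => B t ω - B s ω) (X s) P := by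
    rw [IndepFun_iff_Indep]
    exact indep_of_indep_of_le_right (hB.2.2.2.2 s t hs hst) hm.comap_le
  rw [hind.symm.integral_fun_mul_eq_mul_integral
    (hm.mono (F.le s) le_rfl).aestronglyMeasurable
    ((hB.measurable t).sub (hB.measurable s)).aestronglyMeasurable,
    (hB.moments_sub hs hst).2.2, mul_zero]

end IsSolutionSFDE

end Diffusion

section Centering

variable {H : Type*} [NormedAddCommGroup H] [InnerProductSpace ℝ H]

/-- The projection along `e`, orthogonal when `e` is a unit vector. -/
def projOut (e : H) : H →L[ℝ] H :=
  ContinuousLinearMap.id ℝ H - (innerSL ℝ e).smulRight e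

theorem projOut_apply (e v : H) : projOut e v = v - inner ℝ e v • e := by
  simp [projOut]

theorem projOut_self {e : H} (he : ‖e‖ = 1) : projOut e e = 0 := by
  simp [projOut_apply, he]

theorem inner_projOut {e : H} (he : ‖e‖ = 1) (v w : H) :
    inner ℝ (projOut e v) (projOut e w) = inner ℝ v w - inner ℝ e v * inner ℝ e w := by
  simp only [projOut_apply, inner_sub_left, inner_sub_right, real_inner_smul_left,
    real_inner_smul_right, real_inner_self_eq_norm_sq, he, real_inner_comm e v]
  ring

end Centering

section Assembly

variable {Ω : Type*} {mΩ : MeasurableSpace Ω} {P : Measure Ω} [IsProbabilityMeasure P]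

/-- The constant random variable `1` as an element of `L²`. -/
def oneLTwo (P : Measure Ω) [IsProbabilityMeasure P] : Lp ℝ 2 P :=
  (IsLTwoFamily.const (P := P) 1).curve 0

theorem inner_oneLTwo_curve {V : ℝ → Ω → ℝ} (hV : IsLTwoFamily P V) {t : ℝ} (ht : 0 ≤ t) :
    inner ℝ (oneLTwo P) (hV.curve t) = ∫ ω, V t ω ∂P := by
  rw [oneLTwo, IsLTwoFamily.inner_curve_curve _ hV le_rfl ht]
  simp only [one_mul]

theorem norm_oneLTwo : ‖oneLTwo P‖ = 1 := by
  have h : ‖oneLTwo P‖ ^ 2 = 1 := by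
    rw [← real_inner_self_eq_norm_sq]
    nth_rewrite 2 [oneLTwo]
    rw [inner_oneLTwo_curve _ le_rfl]
    simp
  exact (pow_eq_one_iff_of_nonneg (norm_nonneg _) two_ne_zero).1 h

theorem inner_projOut_curve {V : ℝ → Ω → ℝ} (hV : IsLTwoFamily P V) {s t : ℝ} (hs : 0 ≤ s)
    (ht : 0 ≤ t) :
    inner ℝ (projOut (oneLTwo P) (hV.curve s)) (projOut (oneLTwo P) (hV.curve t))
      = rcov P (V s) (V t) := by
  rw [inner_projOut norm_oneLTwo, hV.inner_curve_curve hV hs ht, inner_oneLTwo_curve hV hs,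
    inner_oneLTwo_curve hV ht, rcov]

/-- The centered equation satisfied by an `L²` process whose paths solve an affine
integro-differential equation. -/
theorem projOut_curve_eq {V W : ℝ → Ω → ℝ} (hV : IsLTwoFamily P V) (hW : IsLTwoFamily P W)
    (hWc : Continuous hW.curve) (hW0 : ∀ t, 0 ≤ t → ∫ ω, W t ω ∂P = 0) {ρ : ℝ → ℝ}
    (hρ : Continuous ρ) {a K p σ : ℝ}
    (h : ∀ᵐ ω ∂P, ∀ t, 0 ≤ t → V t ω = p
      + (∫ s in (0 : ℝ)..t, (a * V s ω + ρ s * (K + ∫ u in (0 : ℝ)..s, V u ω))) + σ * W t ω) :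
    Continuous hV.curve ∧ ∀ t, 0 ≤ t → projOut (oneLTwo P) (hV.curve t)
      = (∫ s in (0 : ℝ)..t, (a • projOut (oneLTwo P) (hV.curve s)
        + ρ s • ∫ u in (0 : ℝ)..s, projOut (oneLTwo P) (hV.curve u))) + σ • hW.curve t := by
  have hρ' : Continuous fun t => ρ (max t 0) := by fun_prop
  have hk := IsLTwoFamily.const (P := P) K
  have hp := IsLTwoFamily.const (P := P) p
  have ha : Continuous fun _ : ℝ => a := continuous_const
  have hσ : Continuous fun _ : ℝ => σ := continuous_const
  have hK := hk.add hV.primitive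
  have hD := (hV.mul_left ha).add (hK.mul_left hρ)
  have hR := (hp.add hD.primitive).add (hW.mul_left hσ)
  have heq : ∀ t, hV.curve t = p • oneLTwo P + hD.primitive.curve t + σ • hW.curve t := by
    intro t
    rw [← hV.curve_max, hV.curve_congr hR (le_max_right t 0)
      (h.mono fun ω hω => hω _ (le_max_right t 0)), hR.curve_max,
      (hp.add hD.primitive).curve_add (hW.mul_left hσ), hp.curve_add hD.primitive,
      IsLTwoFamily.curve_const, hW.curve_mul_left hσ, oneLTwo]
  have hVc : Continuous hV.curve := by
    rw [show hV.curve = _ from funext heq]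
    have := hD.continuous_curve_primitive
    fun_prop
  have hDeq : ∀ t, hD.curve t = a • hV.curve t
      + ρ (max t 0) • (K • oneLTwo P + hV.primitive.curve t) := by
    intro t
    rw [(hV.mul_left ha).curve_add (hK.mul_left hρ), hV.curve_mul_left ha, hK.curve_mul_left hρ,
      hk.curve_add hV.primitive, IsLTwoFamily.curve_const, oneLTwo]
  have hDc : Continuous hD.curve := by
    rw [show hD.curve = _ from funext hDeq]
    have := hV.continuous_curve_primitive
    fun_prop
  refine ⟨hVc, fun t ht => ?_⟩
  have hWp : projOut (oneLTwo P) (hW.curve t) = hW.curve t := by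
    rw [projOut_apply, inner_oneLTwo_curve hW ht, hW0 t ht, zero_smul, sub_zero]
  rw [heq t, map_add, map_add, map_smul, map_smul, projOut_self norm_oneLTwo, smul_zero, zero_add,
    hWp, hD.curve_primitive hDc ht,
    ← (projOut (oneLTwo P)).intervalIntegral_comp_comm (hDc.intervalIntegrable _ _)]
  congr 1
  apply intervalIntegral.integral_congr
  intro s hs
  rw [uIcc_of_le ht] at hs
  simp only [hDeq s]
  rw [map_add, map_smul, map_smul, map_add, map_smul, projOut_self norm_oneLTwo, smul_zero,
    zero_add, max_eq_left hs.1, hV.curve_primitive hVc hs.1,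
    ← (projOut (oneLTwo P)).intervalIntegral_comp_comm (hVc.intervalIntegrable _ _)]

end Assembly

theorem sfde_ct_asymptotics_b_neg {Ω : Type*} {mΩ : MeasurableSpace Ω} (P : Measure Ω) [IsProbabilityMeasure P]
    (F : MeasureTheory.Filtration ℝ mΩ) (a b σ : ℝ) (ψ : ℝ → ℝ) (B X : ℝ → Ω → ℝ)
    (hσ : 0 < σ) (hψ : ContinuousOn ψ (Set.Icc (-1 : ℝ) 0))
    (hB : IsStdBrownian P F B) (hX : IsSolutionSFDE P F a b σ ψ B X)
    (ha : a < 0) (hb : b < 0) (c : ℝ → ℝ)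
    (hc : ∀ t : ℝ, 0 ≤ t → Filter.Tendsto
      (fun Δ : ℝ => Δ ^ (1 + b / a) * rcov P (X t) (X (t + Δ)))
      Filter.atTop (nhds (c t))) :
    Filter.Tendsto (fun t : ℝ => c t / t ^ (b / a)) Filter.atTop
      (nhds (σ ^ 2 * b * (|b| + |a|) / (|a| ^ 3 * (2 * |b| + |a|)))) ∧
    σ ^ 2 * b * (|b| + |a|) / (|a| ^ 3 * (2 * |b| + |a|)) < 0 ∧
    Filter.Tendsto c Filter.atTop Filter.atBot := by
  have ha0 : a ≠ 0 := ha.ne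
  have hα : 0 < -a := neg_pos.2 ha
  have hβ : 0 < b / a := div_pos_of_neg_of_neg hb ha
  have hW := hB.isLTwoFamily
  have hV := hX.isLTwoFamily hB
  have hρ : Continuous fun t : ℝ => b / (1 + max t 0) := by
    refine continuous_const.div (by fun_prop) fun t => ?_
    have := le_max_right t 0
    linarith
  have hW0 : ∀ t : ℝ, 0 ≤ t → ∫ ω, B (max t 0) ω ∂P = 0 := fun t ht => by
    rw [max_eq_left ht]
    exact (hB.moments ht).2.2
  obtain ⟨hVc, heq⟩ := projOut_curve_eq hV hW hB.continuous_curve hW0 hρ hX.ae_eq_integral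
  have hlim := hilbert_correlation_asymptotics (σ := σ) (c := c) hα hβ hB.isHilbertBrownian
    (x := fun t => projOut (oneLTwo P) (hV.curve t)) ((projOut (oneLTwo P)).continuous.comp hVc)
    (fun s t hs hst => by
      have ht := hs.trans hst
      have h1 : inner ℝ (hV.curve s) (hW.curve t - hW.curve s) = 0 := by
        rw [L2.inner_def]
        refine Eq.trans (integral_congr_ae ?_) (hX.integral_mul_sub_eq_zero hB hs hst)
        filter_upwards [Lp.coeFn_sub (hW.curve t) (hW.curve s), hV.coeFn_curve hs,
          hW.coeFn_curve hs, hW.coeFn_curve ht] with ω h1 h2 h3 h4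
        rw [h1, Pi.sub_apply, h2, h3, h4, max_eq_left hs, max_eq_left ht]
        simp [mul_comm]
      rw [projOut_apply, inner_sub_left, h1, real_inner_smul_left, inner_sub_right,
        inner_oneLTwo_curve hW hs, inner_oneLTwo_curve hW ht, hW0 s hs, hW0 t ht]
      simp)
    (fun t ht => by
      rw [heq t ht]
      congr 1
      apply intervalIntegral.integral_congr
      intro s hs
      rw [uIcc_of_le ht] at hs
      have hab : -a * (b / a) = -b := by field_simp
      simp only [max_eq_left hs.1, neg_neg, hab, neg_div, neg_smul, sub_neg_eq_add])
    (fun t ht => by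
      refine (hc t ht).congr' ?_
      filter_upwards [eventually_ge_atTop 0] with Δ hΔ
      rw [inner_projOut_curve hV ht (add_nonneg ht hΔ), max_eq_left ht,
        max_eq_left (add_nonneg ht hΔ)])
  have hconst : -(b / a * (σ ^ 2 * (b / a + 1) / ((-a) ^ 2 * (2 * (b / a) + 1))))
      = σ ^ 2 * b * (|b| + |a|) / (|a| ^ 3 * (2 * |b| + |a|)) := by
    rw [abs_of_neg ha, abs_of_neg hb]
    have h1 : 2 * b + a ≠ 0 := by linarith
    have h2 : 2 * (b / a) + 1 = (2 * b + a) / a := by field_simp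
    have h3 : 2 * -b + -a = -(2 * b + a) := by ring
    rw [h2, h3]
    field_simp
    ring
  rw [hconst] at hlim
  have hneg : σ ^ 2 * b * (|b| + |a|) / (|a| ^ 3 * (2 * |b| + |a|)) < 0 := by
    have h1 := abs_pos.2 ha.ne
    have h2 := abs_pos.2 hb.ne
    refine div_neg_of_neg_of_pos (mul_neg_of_neg_of_pos ?_ (by positivity)) (by positivity)
    exact mul_neg_of_pos_of_neg (by positivity) hb
  refine ⟨hlim, hneg, (hlim.neg_mul_atTop hneg (tendsto_rpow_atTop hβ)).congr' ?_⟩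
  filter_upwards [eventually_gt_atTop 0] with t ht
  exact div_mul_cancel₀ _ (rpow_pos_of_pos ht _).ne'
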